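/- arXiv:2108.13882 — 5 statements merged into one kernel-verified Lean document; each statement's English description precedes it below -/
import Mathlib

section
/- Let d ≥ 1, let A ∈ M_d(ℤ) be non-singular and let v ∈ ℚ^d. The sequence (A^n ω v)_{n≥0} is uniformly distributed modulo 1 for Lebesgue-almost every ω ∈ ℝ if and only if A is non-degenerate, no eigenvalue of A is a root of unity, and the vectors v, Av, …, A^{d−1}v are linearly independent over ℝ. -/
open MeasureTheory Filter Matrix

/-- A sequence in `ℝ^d` is uniformly distributed modulo 1 if the Birkhoff-type averages of
every continuous `ℤ^d`-periodic function converge to its integral over the torus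
(realized as the unit cube `[0,1]^d` with Lebesgue measure). -/
def UDMod1 {d : ℕ} (x : ℕ → (Fin d → ℝ)) : Prop :=
  ∀ f : (Fin d → ℝ) → ℂ, Continuous f →
    (∀ (y : Fin d → ℝ) (k : Fin d → ℤ), f (y + fun i => (k i : ℝ)) = f y) →
    Tendsto (fun N : ℕ => (N : ℂ)⁻¹ • ∑ n ∈ Finset.range N, f (x n)) atTop
      (nhds (∫ y in Set.Icc (0 : Fin d → ℝ) 1, f y))

/-- A complex number is a root of unity. -/
def IsRootOfUnity (z : ℂ) : Prop := ∃ n : ℕ, 0 < n ∧ z ^ n = 1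

section Recurrence

variable {d : ℕ} {R : Type*} [CommRing R]

/-- The linear recurrence sequence `n ↦ h · Bⁿ x`. -/
def linRec (B : Matrix (Fin d) (Fin d) R) (h x : Fin d → R) (n : ℕ) : R :=
  h ⬝ᵥ (B ^ n *ᵥ x)

theorem linRec_eq_sum (B : Matrix (Fin d) (Fin d) R) (n : ℕ) :
    ∃ c : ℕ → R, ∀ h x : Fin d → R,
      linRec B h x n = ∑ i ∈ Finset.range d, c i * linRec B h x i := by
  nontriviality R
  rcases Nat.eq_zero_or_pos d with rfl | hd
  · exact ⟨0, fun h x => by simp [linRec]⟩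
  refine ⟨fun i => (Polynomial.X ^ n %ₘ B.charpoly).coeff i, fun h x => ?_⟩
  have hB : B ^ n =
      ∑ i ∈ Finset.range d, (Polynomial.X ^ n %ₘ B.charpoly).coeff i • B ^ i := by
    rw [B.pow_eq_aeval_mod_charpoly n, Polynomial.aeval_def, Polynomial.eval₂_eq_sum_range']
    rotate_left
    · exact d
    · by_cases h0 : Polynomial.X ^ n %ₘ B.charpoly = 0
      · rw [h0, Polynomial.natDegree_zero]
        exact hd
      · rw [Polynomial.natDegree_lt_iff_degree_lt h0]
        have := Polynomial.degree_modByMonic_lt (Polynomial.X ^ n) B.charpoly_monic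
        rwa [B.charpoly_degree_eq_dim, Fintype.card_fin] at this
    · simp [Algebra.smul_def]
  rw [linRec, hB, Matrix.sum_mulVec, dotProduct_sum]
  simp [linRec, Matrix.smul_mulVec, dotProduct_smul]

theorem dvd_linRec {B : Matrix (Fin d) (Fin d) R} {h x : Fin d → R} {c : R}
    (H : ∀ n < d, c ∣ linRec B h x n) (n : ℕ) : c ∣ linRec B h x n := by
  obtain ⟨a, ha⟩ := linRec_eq_sum B n
  rw [ha]
  exact Finset.dvd_sum fun i hi => (H i (Finset.mem_range.1 hi)).mul_left _

theorem linRec_eq_zero {B : Matrix (Fin d) (Fin d) R} {h x : Fin d → R}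
    (H : ∀ n < d, linRec B h x n = 0) (n : ℕ) : linRec B h x n = 0 := by
  have := dvd_linRec (B := B) (h := h) (x := x) (c := 0) (fun n hn => by rw [H n hn]) n
  exact zero_dvd_iff.1 this

theorem linRec_pow_add (B : Matrix (Fin d) (Fin d) R) (h x : Fin d → R) (a m n : ℕ) :
    linRec (B ^ a) h (B ^ m *ᵥ x) n = linRec B h x (m + a * n) := by
  simp only [linRec, Matrix.mulVec_mulVec, ← pow_mul, ← pow_add, add_comm]

theorem linRec_one_add_smul (B : Matrix (Fin d) (Fin d) R) (h x : Fin d → R) (p : R) (n : ℕ) :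
    linRec (1 + p • B) h x n =
      ∑ j ∈ Finset.range (n + 1), (n.choose j : R) * (p ^ j * linRec B h x j) := by
  have hc : (1 + p • B) ^ n = ∑ j ∈ Finset.range (n + 1), ((n.choose j : R) * p ^ j) • B ^ j := by
    rw [add_comm, (Commute.one_right (p • B)).add_pow]
    refine Finset.sum_congr rfl fun j _ => ?_
    rw [one_pow, mul_one, smul_pow, mul_comm (n.choose j : R), mul_smul, ← nsmul_eq_mul',
      Nat.cast_smul_eq_nsmul, smul_comm]
  rw [linRec, hc, Matrix.sum_mulVec, dotProduct_sum]
  simp [linRec, Matrix.smul_mulVec, dotProduct_smul, mul_assoc]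

end Recurrence

section PadicZeros

/-- An integer polynomial taking, at some natural number, a value not divisible by `p ^ m` has
few zeros modulo `p ^ m`, up to congruence modulo `p`. -/
theorem exists_finset_of_dvd_eval {p : ℕ} (hp : p.Prime) (m : ℕ) (g : Polynomial ℤ)
    (k : ℤ) (hk : ¬ (p : ℤ) ^ m ∣ g.eval k) :
    ∃ S : Finset (ZMod p), S.card ≤ g.natDegree ∧
      ∀ n : ℕ, (p : ℤ) ^ m ∣ g.eval (n : ℤ) → (n : ZMod p) ∈ S := by
  have : Fact p.Prime := ⟨hp⟩
  have hpi : Prime (p : ℤ) := Nat.prime_iff_prime_int.1 hp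
  have hev : ∀ a : ℤ, g.eval a = g.content * g.primPart.eval a := fun a => by
    conv_lhs => rw [g.eq_C_content_mul_primPart]
    rw [Polynomial.eval_mul, Polynomial.eval_C]
  have hc : ¬ (p : ℤ) ^ m ∣ g.content := fun h => hk (by rw [hev]; exact h.mul_right _)
  have hc0 : g.content ≠ 0 := fun h => hc (by rw [h]; exact dvd_zero _)
  obtain ⟨c, hpc, hceq⟩ := (Int.finiteMultiplicity_iff.2
    ⟨by simpa using hp.one_lt.ne', hc0⟩ :
      FiniteMultiplicity (p : ℤ) g.content).exists_eq_pow_mul_and_not_dvd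
  generalize hct : multiplicity (p : ℤ) g.content = t at hpc
  have htm : t < m := by
    by_contra hcon
    exact hc (by rw [hpc]; exact (pow_dvd_pow _ (not_lt.1 hcon)).mul_right _)
  set G := g.primPart.map (Int.castRingHom (ZMod p)) with hG
  have hG0 : G ≠ 0 := by
    intro h0
    have hd : Polynomial.C (p : ℤ) ∣ g.primPart := by
      rw [Polynomial.C_dvd_iff_dvd_coeff]
      intro i
      have := congrArg (fun q => Polynomial.coeff q i) h0
      simp only [hG, Polynomial.coeff_map, Polynomial.coeff_zero, eq_intCast] at this
      exact (ZMod.intCast_zmod_eq_zero_iff_dvd _ _).1 this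
    exact hpi.not_isUnit (g.isPrimitive_primPart _ hd)
  refine ⟨G.roots.toFinset, ?_, fun n hn => ?_⟩
  · calc _ ≤ G.roots.card := Multiset.toFinset_card_le _
      _ ≤ G.natDegree := G.card_roots'
      _ ≤ g.primPart.natDegree := Polynomial.natDegree_map_le
      _ = _ := g.natDegree_primPart
  · rw [Multiset.mem_toFinset, Polynomial.mem_roots hG0, Polynomial.IsRoot, hG]
    have h1 : (p : ℤ) ∣ g.primPart.eval (n : ℤ) := by
      rw [hev, hpc, mul_assoc, ← Nat.add_sub_cancel' htm.le, pow_add] at hn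
      have h2 := (mul_dvd_mul_iff_left (pow_ne_zero t hpi.ne_zero)).1 hn
      have h3 := (dvd_pow_self (p : ℤ) (Nat.sub_ne_zero_of_lt htm)).trans h2
      exact (hpi.dvd_or_dvd h3).resolve_left hceq
    have h4 := (ZMod.intCast_zmod_eq_zero_iff_dvd _ p).2 h1
    rw [← h4]
    simp

theorem exists_finset_of_linRec_eq_zero {d p : ℕ} (hp : p.Prime) (hdp : d ≤ p)
    (B : Matrix (Fin d) (Fin d) ℤ) (h x : Fin d → ℤ) (k : ℕ)
    (hk : linRec (1 + (p : ℤ) • B) h x k ≠ 0) :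
    ∃ S : Finset (ZMod p), S.card ≤ d ∧
      ∀ n : ℕ, linRec (1 + (p : ℤ) • B) h x n = 0 → (n : ZMod p) ∈ S := by
  have hpi : Prime (p : ℤ) := Nat.prime_iff_prime_int.1 hp
  set y := linRec B h x with hy
  have hy0 : ∃ j < d, y j ≠ 0 := by
    by_contra! hcon
    refine hk ?_
    rw [linRec_one_add_smul]
    exact Finset.sum_eq_zero fun j _ => by rw [linRec_eq_zero hcon, mul_zero, mul_zero]
  have hex : ∃ e, ¬ ∀ j < d, (p : ℤ) ^ e ∣ y j := by
    obtain ⟨j, hj, hj0⟩ := hy0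
    have := (Int.finiteMultiplicity_iff.2 ⟨by simpa using hp.one_lt.ne', hj0⟩ :
      FiniteMultiplicity (p : ℤ) (y j))
    obtain ⟨e, he⟩ := this
    exact ⟨e + 1, fun H => he (H j hj)⟩
  obtain ⟨e, he1, he2⟩ : ∃ e, (∀ j < d, (p : ℤ) ^ e ∣ y j) ∧
      ¬ ∀ j < d, (p : ℤ) ^ (e + 1) ∣ y j := by
    classical
    have hs := Nat.find_spec hex
    have hm := fun m => Nat.find_min hex (m := m)
    rcases hf : Nat.find hex with _ | e
    · rw [hf] at hs
      exact absurd (fun j _ => by simp) hs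
    · rw [hf] at hs hm
      exact ⟨e, not_not.1 (hm e (Nat.lt_succ_self e)), hs⟩
  have hyall : ∀ j, (p : ℤ) ^ e ∣ y j := dvd_linRec he1
  set g : Polynomial ℤ := ∑ j ∈ Finset.range d,
    Polynomial.C ((((d - 1).factorial / j.factorial : ℕ) : ℤ) * ((p : ℤ) ^ j * y j)) *
      descPochhammer ℤ j with hg
  have hgdeg : g.natDegree ≤ d := by
    refine Polynomial.natDegree_sum_le_of_forall_le _ _ fun j hj => ?_
    refine (Polynomial.natDegree_C_mul_le _ _).trans ?_
    rw [descPochhammer_natDegree]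
    exact (Finset.mem_range.1 hj).le
  have hgev : ∀ n : ℕ, g.eval (n : ℤ) = ((d - 1).factorial : ℤ) *
      ∑ j ∈ Finset.range d, (n.choose j : ℤ) * ((p : ℤ) ^ j * y j) := by
    intro n
    rw [hg, Polynomial.eval_finsetSum, Finset.mul_sum]
    refine Finset.sum_congr rfl fun j hj => ?_
    rw [Polynomial.eval_mul, Polynomial.eval_C, descPochhammer_eval_eq_descFactorial,
      Nat.descFactorial_eq_factorial_mul_choose]
    have hdv : j.factorial ∣ (d - 1).factorial :=
      Nat.factorial_dvd_factorial (by have := Finset.mem_range.1 hj; omega)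
    conv_rhs => rw [← Nat.div_mul_cancel hdv]
    push_cast
    ring
  have hcop : ∀ a : ℤ, (p : ℤ) ^ (d + e) ∣ ((d - 1).factorial : ℤ) * a →
      (p : ℤ) ^ (d + e) ∣ a := by
    intro a ha
    have : IsCoprime ((p : ℤ) ^ (d + e)) ((d - 1).factorial : ℤ) := by
      apply IsCoprime.pow_left
      rw [Nat.isCoprime_iff_coprime]
      exact hp.coprime_factorial_of_lt (by have := hp.pos; omega)
    exact this.dvd_of_dvd_mul_left ha
  obtain ⟨n₀, hn₀⟩ : ∃ n : ℕ, ¬ (p : ℤ) ^ (d + e) ∣ g.eval (n : ℤ) := by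
    by_contra! hcon
    refine he2 fun j hj => ?_
    have key : (p : ℤ) ^ (d + e) ∣ (p : ℤ) ^ j * y j := by
      induction j using Nat.strong_induction_on with
      | _ j ih =>
        have h1 := hcop _ ((hgev j) ▸ hcon j)
        rw [← Finset.sum_subset (Finset.range_subset_range.2 (Nat.succ_le_of_lt hj)) fun i _ hi => by
          rw [Nat.choose_eq_zero_of_lt (by simpa using hi)]; simp,
          Finset.sum_range_succ, Nat.choose_self, Nat.cast_one, one_mul] at h1
        refine (dvd_add_right (Finset.dvd_sum fun i hi => ?_)).1 h1
        have hij := Finset.mem_range.1 hi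
        exact (ih i hij (hij.trans hj)).mul_left _
    rw [show d + e = j + (d + e - j) by omega, pow_add] at key
    have := (mul_dvd_mul_iff_left (pow_ne_zero j hpi.ne_zero)).1 key
    exact (pow_dvd_pow _ (by omega)).trans this
  obtain ⟨S, hS1, hS2⟩ := exists_finset_of_dvd_eval hp (d + e) g n₀ hn₀
  refine ⟨S, hS1.trans hgdeg, fun n hn => hS2 n ?_⟩
  rw [hgev]
  refine Dvd.dvd.mul_left ?_ _
  rw [linRec_one_add_smul] at hn
  have h2 : ∑ j ∈ Finset.range (d + (n + 1)), (n.choose j : ℤ) * ((p : ℤ) ^ j * y j) = 0 := by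
    rw [← hn]
    symm
    refine Finset.sum_subset (Finset.range_subset_range.2 (by omega)) fun i _ hi => ?_
    rw [Nat.choose_eq_zero_of_lt (by simpa using hi)]
    simp
  rw [Finset.sum_range_add] at h2
  refine (dvd_add_left (Finset.dvd_sum fun i hi => ?_)).1 (h2 ▸ dvd_zero _)
  refine Dvd.dvd.mul_left ?_ _
  rw [pow_add, pow_add, mul_assoc]
  exact mul_dvd_mul_left _ ((hyall _).mul_left _)

end PadicZeros

section CountZeros

variable {d : ℕ}

/-- The sequence `u` vanishes identically on no arithmetic progression. -/
def NoZeroProgression (u : ℕ → ℤ) : Prop := ∀ a ≥ 1, ∀ m, ∃ n, u (m + a * n) ≠ 0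

theorem NoZeroProgression.comp {u : ℕ → ℤ} (hu : NoZeroProgression u) (c : ℕ) {r : ℕ}
    (hr : 1 ≤ r) : NoZeroProgression fun n => u (c + r * n) := by
  intro a ha m
  obtain ⟨n, hn⟩ := hu (r * a) (Nat.mul_pos hr ha) (c + r * m)
  refine ⟨n, ?_⟩
  change u (c + r * (m + a * n)) ≠ 0
  rwa [show c + r * (m + a * n) = c + r * m + r * a * n by ring]

theorem exists_one_add_smul_pow (p : ℤ) (B : Matrix (Fin d) (Fin d) ℤ) (k : ℕ) :
    ∃ B', (1 + p • B) ^ k = 1 + p • B' := by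
  refine ⟨B * ∑ i ∈ Finset.range k, (1 + p • B) ^ i, ?_⟩
  have := mul_geom_sum (1 + p • B) k
  rw [add_sub_cancel_left, smul_mul_assoc] at this
  rw [this, add_sub_cancel]

theorem card_zeros_range_pow_le {p : ℕ} (hp : p.Prime) (hdp : d ≤ p) (h : Fin d → ℤ) (s : ℕ)
    (B : Matrix (Fin d) (Fin d) ℤ) (x : Fin d → ℤ)
    (hu : NoZeroProgression (linRec (1 + (p : ℤ) • B) h x)) :
    ((Finset.range (p ^ s)).filter fun n => linRec (1 + (p : ℤ) • B) h x n = 0).card ≤ d ^ s := by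
  induction s generalizing B x with
  | zero => exact (Finset.card_filter_le _ _).trans (by simp)
  | succ s ih =>
    obtain ⟨k, hk⟩ := hu 1 le_rfl 0
    obtain ⟨S, hS1, hS2⟩ := exists_finset_of_linRec_eq_zero hp hdp B h x _ hk
    have : NeZero p := ⟨hp.ne_zero⟩
    obtain ⟨B', hB'⟩ := exists_one_add_smul_pow (p : ℤ) B p
    have hsub : ((Finset.range (p ^ (s + 1))).filter
        fun n => linRec (1 + (p : ℤ) • B) h x n = 0) ⊆
        S.biUnion fun c => ((Finset.range (p ^ s)).filter fun n =>
          linRec (1 + (p : ℤ) • B') h ((1 + (p : ℤ) • B) ^ c.val *ᵥ x) n = 0).image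
            fun n => c.val + p * n := by
      intro n hn
      rw [Finset.mem_filter, Finset.mem_range] at hn
      refine Finset.mem_biUnion.2 ⟨_, hS2 n hn.2, Finset.mem_image.2 ⟨n / p, ?_, ?_⟩⟩
      · rw [Finset.mem_filter, Finset.mem_range, ← hB', linRec_pow_add, ZMod.val_natCast,
          Nat.mod_add_div]
        exact ⟨Nat.div_lt_of_lt_mul (by rw [← pow_succ']; exact hn.1), hn.2⟩
      · rw [ZMod.val_natCast, Nat.mod_add_div]
    refine (Finset.card_le_card hsub).trans ((Finset.card_biUnion_le_card_mul _ _ (d ^ s)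
      fun c _ => Finset.card_image_le.trans (ih B' _ ?_)).trans ?_)
    · have := hu.comp c.val hp.one_le
      rw [← hB']
      convert this using 2 with n
      exact linRec_pow_add _ _ _ _ _ _
    · rw [pow_succ']
      exact Nat.mul_le_mul_right _ hS1

theorem exists_pow_eq_one_add_smul {p : ℕ} (hp : p.Prime) (A : Matrix (Fin d) (Fin d) ℤ)
    (hA : ¬ (p : ℤ) ∣ A.det) : ∃ r ≥ 1, ∃ B, A ^ r = 1 + (p : ℤ) • B := by
  have : Fact p.Prime := ⟨hp⟩
  set φ := (Int.castRingHom (ZMod p)).mapMatrix (m := Fin d) with hφ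
  have hdet : IsUnit (φ A) := by
    rw [Matrix.isUnit_iff_isUnit_det, hφ, ← RingHom.map_det, isUnit_iff_ne_zero]
    exact fun h0 => hA ((ZMod.intCast_zmod_eq_zero_iff_dvd _ _).1 h0)
  obtain ⟨g, hg⟩ := hdet
  refine ⟨Fintype.card (Matrix (Fin d) (Fin d) (ZMod p))ˣ, Fintype.card_pos, ?_⟩
  generalize hr : Fintype.card (Matrix (Fin d) (Fin d) (ZMod p))ˣ = r
  have h1 : φ (A ^ r - 1) = 0 := by
    rw [map_sub, map_pow, ← hg, map_one, ← Units.val_pow_eq_pow_val, ← hr, pow_card_eq_one,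
      Units.val_one, sub_self]
  have h2 : ∀ i j, ∃ b, (A ^ r - 1) i j = (p : ℤ) * b := fun i j => by
    have := congrFun (congrFun h1 i) j
    exact (ZMod.intCast_zmod_eq_zero_iff_dvd _ _).1 this
  choose B hB using h2
  refine ⟨Matrix.of B, ?_⟩
  rw [← sub_eq_iff_eq_add']
  ext i j
  rw [hB]
  simp

theorem exists_sq_card_zeros_le (A : Matrix (Fin d) (Fin d) ℤ) (hA : A.det ≠ 0) :
    ∃ K : ℕ, ∀ h x : Fin d → ℤ, NoZeroProgression (linRec A h x) → ∀ N : ℕ,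
      ((Finset.range N).filter fun n => linRec A h x n = 0).card ^ 2 ≤ K * N := by
  obtain ⟨p, hple, hp⟩ := Nat.exists_infinite_primes (d ^ 2 + A.det.natAbs + 1)
  have hdp : d ≤ p := (Nat.le_self_pow two_ne_zero d).trans (by omega)
  have hAp : ¬ (p : ℤ) ∣ A.det := fun hdvd => by
    have := Nat.le_of_dvd (Int.natAbs_pos.2 hA) (Int.natCast_dvd.1 hdvd)
    omega
  obtain ⟨r, hr, B, hB⟩ := exists_pow_eq_one_add_smul hp A hAp
  refine ⟨r ^ 2 * p, fun h x hu N => ?_⟩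
  rcases Nat.eq_zero_or_pos N with rfl | hN
  · simp
  obtain ⟨s, hs1, hs2⟩ : ∃ s, N ≤ p ^ s ∧ p ^ s ≤ p * N := by
    refine ⟨Nat.log p N + 1, (Nat.lt_pow_succ_log_self hp.one_lt N).le, ?_⟩
    rw [pow_succ']
    exact Nat.mul_le_mul_left _ (Nat.pow_log_le_self p hN.ne')
  have hcard : ((Finset.range N).filter fun n => linRec A h x n = 0).card ≤ r * d ^ s := by
    have hsub : ((Finset.range N).filter fun n => linRec A h x n = 0) ⊆
        (Finset.range r).biUnion fun c => ((Finset.range (p ^ s)).filter fun n =>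
          linRec (1 + (p : ℤ) • B) h (A ^ c *ᵥ x) n = 0).image fun n => c + r * n := by
      intro n hn
      rw [Finset.mem_filter, Finset.mem_range] at hn
      refine Finset.mem_biUnion.2 ⟨n % r, Finset.mem_range.2 (Nat.mod_lt _ hr),
        Finset.mem_image.2 ⟨n / r, ?_, Nat.mod_add_div n r⟩⟩
      rw [Finset.mem_filter, Finset.mem_range, ← hB, linRec_pow_add, Nat.mod_add_div]
      exact ⟨(Nat.div_le_self _ _).trans_lt (hn.1.trans_le hs1), hn.2⟩
    refine (Finset.card_le_card hsub).trans ((Finset.card_biUnion_le_card_mul _ _ (d ^ s)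
      fun c _ => Finset.card_image_le.trans (card_zeros_range_pow_le hp hdp h s B _ ?_)).trans ?_)
    · rw [← hB]
      convert hu.comp c hr using 2 with n
      exact linRec_pow_add _ _ _ _ _ _
    · rw [Finset.card_range]
  calc _ ≤ (r * d ^ s) ^ 2 := Nat.pow_le_pow_left hcard 2
    _ = r ^ 2 * (d ^ 2) ^ s := by ring
    _ ≤ r ^ 2 * p ^ s := by gcongr; omega
    _ ≤ r ^ 2 * (p * N) := by gcongr
    _ = _ := by ring

end CountZeros

section RatioNondegenerate

variable {d : ℕ}

theorem vecMul_sub_scalar {R : Type*} [CommRing R] (M : Matrix (Fin d) (Fin d) R) (μ : R)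
    (g : Fin d → R) :
    g ᵥ* Polynomial.aeval M (Polynomial.X - Polynomial.C μ) = g ᵥ* M - μ • g := by
  rw [map_sub, Polynomial.aeval_X, Polynomial.aeval_C, Matrix.vecMul_sub,
    Algebra.algebraMap_eq_smul_one, Matrix.vecMul_smul, Matrix.vecMul_one]

theorem isRoot_charpoly_iff {K : Type*} [CommRing K] [IsDomain K]
    (M : Matrix (Fin d) (Fin d) K) (μ : K) :
    M.charpoly.IsRoot μ ↔ ∃ g ≠ 0, g ᵥ* M = μ • g := by
  rw [Polynomial.IsRoot, Matrix.eval_charpoly, ← Matrix.exists_vecMul_eq_zero_iff]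
  refine exists_congr fun g => and_congr_right fun _ => ?_
  rw [Matrix.scalar_apply, Matrix.vecMul_sub, sub_eq_zero, ← Matrix.smul_one_eq_diagonal,
    Matrix.vecMul_smul, Matrix.vecMul_one, eq_comm]

theorem vecMul_aeval_prod_eq_zero {K ι : Type*} [CommRing K] [IsDomain K]
    (M : Matrix (Fin d) (Fin d) K) (μ : ι → K) (s : Finset ι)
    (hs : ∀ i ∈ s, ¬ M.charpoly.IsRoot (μ i)) (g : Fin d → K)
    (hg : g ᵥ* Polynomial.aeval M (∏ i ∈ s, (Polynomial.X - Polynomial.C (μ i))) = 0) :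
    g = 0 := by
  classical
  induction s using Finset.induction_on generalizing g with
  | empty => simpa using hg
  | insert i s hi ih =>
    rw [Finset.prod_insert hi, map_mul, ← Matrix.vecMul_vecMul] at hg
    have h1 := ih (fun j hj => hs j (Finset.mem_insert_of_mem hj)) _ hg
    by_contra h0
    refine hs i (Finset.mem_insert_self _ _) ((isRoot_charpoly_iff M _).2 ⟨g, h0, ?_⟩)
    rwa [vecMul_sub_scalar, sub_eq_zero] at h1

/-- No ratio of two distinct eigenvalues of `M` is a root of unity. -/
def RatioNondegenerate (M : Matrix (Fin d) (Fin d) ℂ) : Prop :=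
  ∀ θ η : ℂ, M.charpoly.IsRoot θ → M.charpoly.IsRoot η → IsRootOfUnity (θ / η) → θ = η

theorem RatioNondegenerate.eigenvector_of_pow
    {M : Matrix (Fin d) (Fin d) ℂ} (hM : RatioNondegenerate M)
    {a : ℕ} (ha : 1 ≤ a) {l : ℂ} (hl : l ≠ 0) {g : Fin d → ℂ} (hg : g ᵥ* M ^ a = l • g) :
    ∃ θ, θ ^ a = l ∧ g ᵥ* M = θ • g := by
  obtain ⟨α, hα⟩ := IsAlgClosed.exists_pow_nat_eq l ha
  have hζ := Complex.isPrimitiveRoot_exp a (by omega)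
  set ζ := Complex.exp (2 * Real.pi * Complex.I / a)
  have hα0 : α ≠ 0 := by
    rintro rfl
    exact hl (by rw [← hα, zero_pow (by omega)])
  have hζ0 : ζ ≠ 0 := hζ.ne_zero (by omega)
  have hprod := X_pow_sub_C_eq_prod hζ ha hα
  obtain ⟨i₀, hi₀, hroot⟩ : ∃ i₀ ∈ Finset.range a, ∀ i ∈ (Finset.range a).erase i₀,
      ¬ M.charpoly.IsRoot (ζ ^ i * α) := by
    by_cases hex : ∃ i ∈ Finset.range a, M.charpoly.IsRoot (ζ ^ i * α)
    · obtain ⟨i₀, hi₀, hr⟩ := hex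
      refine ⟨i₀, hi₀, fun i hi hri => ?_⟩
      rw [Finset.mem_erase, Finset.mem_range] at hi
      refine hi.1 (hζ.pow_inj hi.2 (Finset.mem_range.1 hi₀)
        (mul_right_cancel₀ hα0 (hM _ _ hri hr ⟨a, ha, ?_⟩)))
      rw [div_pow, mul_pow, mul_pow, ← pow_mul, ← pow_mul, mul_comm i, mul_comm i₀, pow_mul,
        pow_mul, hζ.pow_eq_one, one_pow, one_pow, one_mul, div_self (pow_ne_zero _ hα0)]
    · push Not at hex
      exact ⟨0, Finset.mem_range.2 ha, fun i hi => hex i (Finset.mem_of_mem_erase hi)⟩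
  refine ⟨ζ ^ i₀ * α, ?_, ?_⟩
  · rw [mul_pow, ← pow_mul, mul_comm i₀, pow_mul, hζ.pow_eq_one, one_pow, one_mul, hα]
  · have h0 : g ᵥ* Polynomial.aeval M (Polynomial.X ^ a - Polynomial.C l) = 0 := by
      rw [map_sub, map_pow, Polynomial.aeval_X, Polynomial.aeval_C, Matrix.vecMul_sub,
        Algebra.algebraMap_eq_smul_one, Matrix.vecMul_smul, Matrix.vecMul_one, hg, sub_self]
    rw [hprod, ← Finset.mul_prod_erase _ _ hi₀, map_mul, ← Matrix.vecMul_vecMul] at h0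
    have h1 := vecMul_aeval_prod_eq_zero M _ _ hroot _ h0
    rwa [vecMul_sub_scalar, sub_eq_zero] at h1

/-- The matrix with rows `x, Bx, …, B^{d-1}x`. -/
def krylov {R : Type*} [CommRing R] (B : Matrix (Fin d) (Fin d) R) (x : Fin d → R) :
    Matrix (Fin d) (Fin d) R :=
  Matrix.of fun i => B ^ (i : ℕ) *ᵥ x

theorem det_krylov_eq_zero_iff {R : Type*} [CommRing R] [IsDomain R]
    (B : Matrix (Fin d) (Fin d) R) (x : Fin d → R) :
    (krylov B x).det = 0 ↔ ∃ h ≠ 0, ∀ n, linRec B h x n = 0 := by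
  rw [← Matrix.exists_mulVec_eq_zero_iff]
  refine exists_congr fun h => and_congr_right fun _ => ⟨fun H => linRec_eq_zero fun n hn => ?_,
    fun H => funext fun i => ?_⟩
  · have := congrFun H ⟨n, hn⟩
    rwa [Matrix.mulVec, dotProduct_comm] at this
  · have := H i
    rwa [linRec, dotProduct_comm] at this

theorem det_krylov_map {R S : Type*} [CommRing R] [CommRing S] (φ : R →+* S)
    (B : Matrix (Fin d) (Fin d) R) (x : Fin d → R) :
    (krylov (B.map φ) (φ ∘ x)).det = φ (krylov B x).det := by
  rw [RingHom.map_det]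
  congr 1
  ext i j
  have : B.map φ ^ (i : ℕ) = (B ^ (i : ℕ)).map φ := (map_pow φ.mapMatrix B i).symm
  simp only [krylov, this, Matrix.of_apply, RingHom.mapMatrix_apply, Matrix.map_apply,
    RingHom.map_mulVec]

theorem linRec_map {R S : Type*} [CommRing R] [CommRing S] (φ : R →+* S)
    (B : Matrix (Fin d) (Fin d) R) (h x : Fin d → R) (n : ℕ) :
    linRec (B.map φ) (φ ∘ h) (φ ∘ x) n = φ (linRec B h x n) := by
  have : B.map φ ^ n = (B ^ n).map φ := (map_pow φ.mapMatrix B n).symm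
  rw [linRec, linRec, this, RingHom.map_dotProduct]
  congr 1
  ext i
  simp [RingHom.map_mulVec]

theorem linRec_eq_pow_mul {R : Type*} [CommRing R] {M : Matrix (Fin d) (Fin d) R}
    {g : Fin d → R} {θ : R} (hg : g ᵥ* M = θ • g) (x : Fin d → R) (n : ℕ) :
    linRec M g x n = θ ^ n * (g ⬝ᵥ x) := by
  have h : g ᵥ* M ^ n = θ ^ n • g := by
    induction n with
    | zero => simp
    | succ n ih =>
      rw [pow_succ, ← Matrix.vecMul_vecMul, ih, Matrix.smul_vecMul, hg, smul_smul, pow_succ]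
  rw [linRec, Matrix.dotProduct_mulVec, h, smul_dotProduct, smul_eq_mul]

theorem RatioNondegenerate.det_krylov_pow_ne_zero {M : Matrix (Fin d) (Fin d) ℂ}
    (hM : RatioNondegenerate M) (hdet : M.det ≠ 0) {x : Fin d → ℂ} (hx : (krylov M x).det ≠ 0)
    {a : ℕ} (ha : 1 ≤ a) : (krylov (M ^ a) x).det ≠ 0 := by
  intro h0
  obtain ⟨h, hh0, hh⟩ := (det_krylov_eq_zero_iff _ _).1 h0
  let H : Submodule ℂ (Fin d → ℂ) :=
    { carrier := {g | ∀ n, linRec (M ^ a) g x n = 0}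
      add_mem' := fun {g g'} hg hg' n => by
        have h1 := hg n
        have h2 := hg' n
        rw [linRec] at h1 h2 ⊢
        rw [add_dotProduct, h1, h2, add_zero]
      zero_mem' := fun n => by simp [linRec]
      smul_mem' := fun c g hg n => by
        have h1 := hg n
        rw [linRec] at h1 ⊢
        rw [smul_dotProduct, h1, smul_zero] }
  have hinv : ∀ g ∈ H, (M ^ a).vecMulLinear g ∈ H := fun g hg n => by
    have h1 := hg (n + 1)
    rw [linRec, pow_succ', ← Matrix.mulVec_mulVec, Matrix.dotProduct_mulVec] at h1
    exact h1
  let T : Module.End ℂ H := (M ^ a).vecMulLinear.restrict hinv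
  have : Nontrivial H := ⟨⟨⟨h, hh⟩, 0, fun h => hh0 (congrArg Subtype.val h)⟩⟩
  obtain ⟨l, hl⟩ := Module.End.exists_eigenvalue T
  obtain ⟨g, hg⟩ := hl.exists_hasEigenvector
  have hg0 : (g : Fin d → ℂ) ≠ 0 := fun h => hg.2 (Subtype.ext h)
  have hgl : (g : Fin d → ℂ) ᵥ* M ^ a = l • (g : Fin d → ℂ) :=
    congrArg Subtype.val hg.apply_eq_smul
  have hl0 : l ≠ 0 := by
    rintro rfl
    rw [zero_smul] at hgl
    have := Matrix.exists_vecMul_eq_zero_iff.1 ⟨_, hg0, hgl⟩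
    rw [Matrix.det_pow] at this
    exact hdet (pow_eq_zero_iff (by omega) |>.1 this)
  obtain ⟨θ, -, hθ⟩ := hM.eigenvector_of_pow ha hl0 hgl
  refine hx ((det_krylov_eq_zero_iff _ _).2 ⟨g, hg0, fun n => ?_⟩)
  have h1 : linRec (M ^ a) g x 0 = 0 := g.2 0
  rw [linRec, pow_zero, Matrix.one_mulVec] at h1
  rw [linRec_eq_pow_mul hθ, h1, mul_zero]

theorem RatioNondegenerate.det_pow_sub_one_ne_zero {M : Matrix (Fin d) (Fin d) ℂ}
    (hM : RatioNondegenerate M) (hroot : ∀ θ, M.charpoly.IsRoot θ → ¬ IsRootOfUnity θ)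
    {k : ℕ} (hk : 1 ≤ k) : (M ^ k - 1).det ≠ 0 := by
  intro h0
  obtain ⟨g, hg0, hg⟩ := Matrix.exists_vecMul_eq_zero_iff.2 h0
  rw [Matrix.vecMul_sub, Matrix.vecMul_one, sub_eq_zero] at hg
  obtain ⟨θ, hθ1, hθ⟩ := hM.eigenvector_of_pow hk one_ne_zero (by rw [one_smul]; exact hg)
  exact hroot θ ((isRoot_charpoly_iff _ _).2 ⟨g, hg0, hθ⟩) ⟨k, hk, hθ1⟩

theorem RatioNondegenerate.noZeroProgression {A : Matrix (Fin d) (Fin d) ℤ} (hA : A.det ≠ 0)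
    (hM : RatioNondegenerate (A.map (Int.castRingHom ℂ)))
    (hroot : ∀ θ, (A.map (Int.castRingHom ℂ)).charpoly.IsRoot θ → ¬ IsRootOfUnity θ)
    {w : Fin d → ℤ} (hw : (krylov A w).det ≠ 0) {h : Fin d → ℤ} (hh : h ≠ 0)
    {k : ℕ} (hk : 1 ≤ k) : NoZeroProgression (linRec A h ((A ^ k - 1) *ᵥ w)) := by
  intro a ha m
  by_contra! hcon
  have hinj : Function.Injective (Int.castRingHom ℂ) := Int.cast_injective
  have hpow : ∀ j, A.map (Int.castRingHom ℂ) ^ j = (A ^ j).map (Int.castRingHom ℂ) := fun j =>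
    (map_pow (Int.castRingHom ℂ).mapMatrix A j).symm
  have hdet : (A.map (Int.castRingHom ℂ)).det ≠ 0 := by
    have h1 := (Int.castRingHom ℂ).map_det A
    rw [RingHom.mapMatrix_apply] at h1
    rw [← h1]
    exact (map_ne_zero_iff _ hinj).2 hA
  have h1 : (A ^ k - 1).det ≠ 0 := by
    have h2 := hM.det_pow_sub_one_ne_zero hroot hk
    have h3 := (Int.castRingHom ℂ).map_det (A ^ k - 1)
    rw [map_sub, map_one, RingHom.mapMatrix_apply, ← hpow] at h3
    rw [← h3] at h2
    exact (map_ne_zero_iff _ hinj).1 h2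
  have h2 : (krylov (A ^ a) w).det ≠ 0 := by
    have h3 := hM.det_krylov_pow_ne_zero hdet (x := Int.castRingHom ℂ ∘ w)
      (by rw [det_krylov_map]; exact (map_ne_zero_iff _ hinj).2 hw) ha
    rw [hpow, det_krylov_map] at h3
    exact (map_ne_zero_iff _ hinj).1 h3
  refine h2 ((det_krylov_eq_zero_iff _ _).2 ⟨h ᵥ* (A ^ m * (A ^ k - 1)), fun h0 => ?_, fun n => ?_⟩)
  · have := Matrix.exists_vecMul_eq_zero_iff.1 ⟨_, hh, h0⟩
    rw [Matrix.det_mul, Matrix.det_pow] at this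
    exact mul_ne_zero (pow_ne_zero _ hA) h1 this
  · rw [← hcon n, linRec, linRec, ← Matrix.dotProduct_mulVec, Matrix.mulVec_mulVec,
      Matrix.mulVec_mulVec, ← pow_mul, pow_add, mul_assoc, mul_assoc]
    have hc : Commute (A ^ k - 1) (A ^ (a * n)) :=
      ((Commute.refl A).pow_pow _ _).sub_left (Commute.one_left _)
    rw [hc.eq]

theorem exists_linRec_constant {A : Matrix (Fin d) (Fin d) ℤ} {w : Fin d → ℤ}
    (H : ¬ (RatioNondegenerate (A.map (Int.castRingHom ℂ)) ∧
      (∀ θ, (A.map (Int.castRingHom ℂ)).charpoly.IsRoot θ → ¬ IsRootOfUnity θ) ∧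
      (krylov A w).det ≠ 0)) :
    ∃ h ≠ 0, ∃ k ≥ 1, ∀ n, linRec A h w (k * n) = linRec A h w 0 := by
  have hinj : Function.Injective (Int.castRingHom ℂ) := Int.cast_injective
  have hpow : ∀ j, A.map (Int.castRingHom ℂ) ^ j = (A ^ j).map (Int.castRingHom ℂ) := fun j =>
    (map_pow (Int.castRingHom ℂ).mapMatrix A j).symm
  have hkry : ∀ k ≥ 1, (krylov (A ^ k) w).det = 0 →
      ∃ h ≠ 0, ∃ k ≥ 1, ∀ n, linRec A h w (k * n) = linRec A h w 0 := fun k hk h0 => by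
    obtain ⟨h, hh, hz⟩ := (det_krylov_eq_zero_iff _ _).1 h0
    have h1 : ∀ n, linRec A h w (k * n) = 0 := fun n => by
      have := hz n
      rwa [linRec, ← pow_mul] at this
    exact ⟨h, hh, k, hk, fun n => by rw [h1, ← h1 0, mul_zero]⟩
  by_cases hw : (krylov A w).det = 0
  · exact hkry 1 le_rfl (by rwa [pow_one])
  by_cases hroot : ∀ θ, (A.map (Int.castRingHom ℂ)).charpoly.IsRoot θ → ¬ IsRootOfUnity θ
  · have hM : ¬ RatioNondegenerate (A.map (Int.castRingHom ℂ)) := fun hM => H ⟨hM, hroot, hw⟩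
    rw [RatioNondegenerate] at hM
    push Not at hM
    obtain ⟨θ, η, hθ, hη, ⟨k, hk, hk1⟩, hne⟩ := hM
    obtain ⟨g, hg0, hg⟩ := (isRoot_charpoly_iff _ _).1 hθ
    obtain ⟨f, hf0, hf⟩ := (isRoot_charpoly_iff _ _).1 hη
    have hη0 : η ≠ 0 := by
      rintro rfl
      rw [div_zero, zero_pow hk.ne'] at hk1
      exact zero_ne_one hk1
    have hpw : θ ^ k = η ^ k := by
      rwa [div_pow, div_eq_one_iff_eq (pow_ne_zero _ hη0)] at hk1
    refine hkry k hk ((map_eq_zero_iff _ hinj).1 ?_)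
    rw [← det_krylov_map, ← hpow]
    set M := A.map (Int.castRingHom ℂ)
    set x := Int.castRingHom ℂ ∘ w
    have hpowrec : ∀ q n, linRec (M ^ k) q x n = linRec M q x (k * n) := fun q n => by
      rw [linRec, linRec, pow_mul]
    refine (det_krylov_eq_zero_iff _ _).2 ?_
    by_cases hgx : g ⬝ᵥ x = 0
    · exact ⟨g, hg0, fun n => by rw [hpowrec, linRec_eq_pow_mul hg, hgx, mul_zero]⟩
    refine ⟨(f ⬝ᵥ x) • g - (g ⬝ᵥ x) • f, fun h0 => ?_, fun n => ?_⟩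
    · have h1 := congrArg (fun q => q ᵥ* M) h0
      simp only [Matrix.sub_vecMul, Matrix.smul_vecMul, hg, hf, Matrix.zero_vecMul] at h1
      rw [sub_eq_zero] at h0
      rw [smul_comm, h0, smul_comm, ← smul_sub, ← sub_smul] at h1
      rcases smul_eq_zero.1 h1 with h2 | h2
      · exact hgx h2
      · rcases smul_eq_zero.1 h2 with h3 | h3
        · exact hne (sub_eq_zero.1 h3)
        · exact hf0 h3
    · have h1 := linRec_eq_pow_mul hg x (k * n)
      have h2 := linRec_eq_pow_mul hf x (k * n)
      rw [hpowrec]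
      rw [linRec] at h1 h2 ⊢
      rw [sub_dotProduct, smul_dotProduct, smul_dotProduct, h1, h2, pow_mul, hpw, ← pow_mul,
        smul_eq_mul, smul_eq_mul]
      ring
  · push Not at hroot
    obtain ⟨θ, hθ, k, hk, hk1⟩ := hroot
    obtain ⟨g, hg0, hg⟩ := (isRoot_charpoly_iff _ _).1 hθ
    have h0 : (A ^ k - 1).det = 0 := by
      rw [← map_eq_zero_iff _ hinj, RingHom.map_det, map_sub, map_one, RingHom.mapMatrix_apply,
        ← hpow, ← Matrix.exists_vecMul_eq_zero_iff]
      refine ⟨g, hg0, ?_⟩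
      rw [Matrix.vecMul_sub, Matrix.vecMul_one, sub_eq_zero]
      refine dotProduct_eq _ _ fun u => ?_
      have := linRec_eq_pow_mul hg u k
      rwa [hk1, one_mul, linRec, Matrix.dotProduct_mulVec] at this
    obtain ⟨h, hh0, hh⟩ := Matrix.exists_vecMul_eq_zero_iff.2 h0
    rw [Matrix.vecMul_sub, Matrix.vecMul_one, sub_eq_zero] at hh
    refine ⟨h, hh0, k, hk, fun n => ?_⟩
    have := linRec_eq_pow_mul (M := A ^ k) (θ := 1) (by rwa [one_smul]) w n
    rw [linRec, ← pow_mul, one_pow, one_mul] at this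
    rw [linRec, this, linRec, pow_zero, Matrix.one_mulVec]

end RatioNondegenerate

section Weyl

variable {d : ℕ}

/-- The additive character `t ↦ exp (2πit)`. -/
noncomputable def expTwoPi (t : ℝ) : ℂ := Complex.exp (2 * Real.pi * Complex.I * t)

theorem expTwoPi_zero : expTwoPi 0 = 1 := by simp [expTwoPi]

theorem expTwoPi_add (s t : ℝ) : expTwoPi (s + t) = expTwoPi s * expTwoPi t := by
  rw [expTwoPi, expTwoPi, expTwoPi, ← Complex.exp_add]
  push_cast
  ring_nf

theorem expTwoPi_intCast (k : ℤ) : expTwoPi k = 1 := by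
  rw [expTwoPi]
  convert Complex.exp_int_mul_two_pi_mul_I k using 2
  push_cast
  ring

theorem norm_expTwoPi (t : ℝ) : ‖expTwoPi t‖ = 1 := by
  rw [expTwoPi, Complex.norm_exp]
  simp

theorem conj_expTwoPi (t : ℝ) : (starRingEnd ℂ) (expTwoPi t) = expTwoPi (-t) := by
  rw [expTwoPi, expTwoPi, ← Complex.exp_conj]
  congr 1
  simp only [map_mul, Complex.conj_ofReal, Complex.conj_I, Complex.conj_ofNat, Complex.ofReal_neg]
  ring

@[fun_prop]
theorem continuous_expTwoPi : Continuous expTwoPi := by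
  unfold expTwoPi
  fun_prop

theorem expTwoPi_sum {ι : Type*} (s : Finset ι) (f : ι → ℝ) :
    expTwoPi (∑ i ∈ s, f i) = ∏ i ∈ s, expTwoPi (f i) := by
  classical
  induction s using Finset.induction_on with
  | empty => simp [expTwoPi_zero]
  | insert i s hi ih => rw [Finset.sum_insert hi, Finset.prod_insert hi, expTwoPi_add, ih]

theorem integral_expTwoPi (k : ℤ) :
    ∫ t in (0 : ℝ)..1, expTwoPi (k * t) = if k = 0 then 1 else 0 := by
  split_ifs with hk
  · simp [hk, expTwoPi_zero]
  · have hc : (2 * Real.pi * Complex.I * k : ℂ) ≠ 0 :=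
      mul_ne_zero Complex.two_pi_I_ne_zero (Int.cast_ne_zero.2 hk)
    have h1 : ∀ t : ℝ, expTwoPi (k * t) = Complex.exp (2 * Real.pi * Complex.I * k * t) := fun t => by
      rw [expTwoPi]
      push_cast
      ring_nf
    simp_rw [h1]
    rw [integral_exp_mul_complex hc]
    have h2 := expTwoPi_intCast k
    rw [expTwoPi, Complex.ofReal_intCast] at h2
    simp [h2]

theorem integral_cube_expTwoPi (h : Fin d → ℤ) (hh : h ≠ 0) :
    ∫ y in Set.Icc (0 : Fin d → ℝ) 1, expTwoPi (∑ i, h i * y i) = 0 := by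
  obtain ⟨i, hi⟩ := Function.ne_iff.1 hh
  rw [← Set.pi_univ_Icc, volume_pi, Measure.restrict_pi_pi]
  simp_rw [expTwoPi_sum]
  rw [integral_fintype_prod_eq_prod (f := fun i (t : ℝ) => expTwoPi (h i * t))]
  refine Finset.prod_eq_zero (Finset.mem_univ i) ?_
  have := integral_expTwoPi (h i)
  rw [if_neg (show h i ≠ 0 from hi), intervalIntegral.integral_of_le zero_le_one,
    ← integral_Icc_eq_integral_Ioc] at this
  exact this

theorem UDMod1.tendsto_expTwoPi {x : ℕ → Fin d → ℝ} (hx : UDMod1 x) (h : Fin d → ℤ) (hh : h ≠ 0) :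
    Tendsto (fun N : ℕ => (N : ℂ)⁻¹ * ∑ n ∈ Finset.range N, expTwoPi (∑ i, h i * x n i)) atTop
      (nhds 0) := by
  rw [← integral_cube_expTwoPi h hh]
  refine hx (fun y => expTwoPi (∑ i, h i * y i)) (by fun_prop) fun y k => ?_
  have : ∑ i, (h i : ℝ) * (y + fun i => (k i : ℝ)) i =
      ∑ i, h i * y i + ((∑ i, h i * k i : ℤ) : ℝ) := by
    push_cast
    rw [← Finset.sum_add_distrib]
    exact Finset.sum_congr rfl fun i _ => by rw [Pi.add_apply, mul_add]
  simp only [this, expTwoPi_add, expTwoPi_intCast, mul_one]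

/-- The projection from `ℝ^d` to the torus. -/
def toTorus (y : Fin d → ℝ) : UnitAddTorus (Fin d) := fun i => (y i : UnitAddCircle)

@[fun_prop]
theorem continuous_toTorus : Continuous (toTorus : (Fin d → ℝ) → _) :=
  continuous_pi fun i => (AddCircle.continuous_mk' 1).comp (continuous_apply i)

theorem mFourier_toTorus (h : Fin d → ℤ) (y : Fin d → ℝ) :
    UnitAddTorus.mFourier h (toTorus y) = expTwoPi (∑ i, h i * y i) := by
  rw [expTwoPi_sum]
  change ∏ i, fourier (h i) (toTorus y i) = _
  refine Finset.prod_congr rfl fun i _ => ?_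
  rw [toTorus, fourier_coe_apply, expTwoPi]
  push_cast
  ring_nf

theorem exists_continuousMap_comp_toTorus (f : (Fin d → ℝ) → ℂ) (hf : Continuous f)
    (hper : ∀ (y : Fin d → ℝ) (k : Fin d → ℤ), f (y + fun i => (k i : ℝ)) = f y) :
    ∃ F : C(UnitAddTorus (Fin d), ℂ), ∀ y, F (toTorus y) = f y := by
  have hq : IsOpenQuotientMap (toTorus : (Fin d → ℝ) → UnitAddTorus (Fin d)) :=
    IsOpenQuotientMap.piMap fun _ => QuotientAddGroup.isOpenQuotientMap_mk
  obtain ⟨σ, hσ⟩ := hq.surjective.hasRightInverse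
  have hfac : ∀ y, f (σ (toTorus y)) = f y := fun y => by
    have h1 : ∀ i, ∃ k : ℤ, σ (toTorus y) i = y i + k := fun i => by
      have h2 := congrFun (hσ (toTorus y)) i
      rw [← sub_eq_zero, toTorus, toTorus, ← AddCircle.coe_sub, AddCircle.coe_eq_zero_iff] at h2
      obtain ⟨k, hk⟩ := h2
      exact ⟨k, by rw [← sub_eq_iff_eq_add', ← hk, zsmul_one]⟩
    choose k hk using h1
    rw [← hper y k]
    exact congrArg f (funext hk)
  refine ⟨⟨f ∘ σ, hq.isQuotientMap.continuous_iff.2 ?_⟩, hfac⟩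
  convert hf using 1
  exact funext hfac

theorem udMod1_of_tendsto_expTwoPi {x : ℕ → Fin d → ℝ}
    (hx : ∀ h : Fin d → ℤ, h ≠ 0 →
      Tendsto (fun N : ℕ => (N : ℂ)⁻¹ * ∑ n ∈ Finset.range N, expTwoPi (∑ i, h i * x n i)) atTop
        (nhds 0)) : UDMod1 x := by
  intro f hf hper
  obtain ⟨F, hF⟩ := exists_continuousMap_comp_toTorus f hf hper
  simp_rw [← hF]
  clear hF hper hf f
  set μ := (volume : Measure (Fin d → ℝ)).restrict (Set.Icc 0 1) with hμ
  have hprob : IsProbabilityMeasure μ := ⟨by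
    rw [hμ, Measure.restrict_apply_univ, Real.volume_Icc_pi]
    simp⟩
  have hint : ∀ P : C(UnitAddTorus (Fin d), ℂ), Integrable (fun y => P (toTorus y)) μ :=
    fun P => ((P.continuous.comp continuous_toTorus).continuousOn).integrableOn_compact
      isCompact_Icc
  let Q : Submodule ℂ C(UnitAddTorus (Fin d), ℂ) :=
    { carrier := {P | Tendsto (fun N : ℕ =>
        (N : ℂ)⁻¹ • ∑ n ∈ Finset.range N, P (toTorus (x n))) atTop
          (nhds (∫ y, P (toTorus y) ∂μ))}
      add_mem' := fun {P P'} hP hP' => by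
        have := Tendsto.add hP hP'
        rw [← integral_add (hint P) (hint P')] at this
        refine this.congr fun N => ?_
        rw [← smul_add, ← Finset.sum_add_distrib]
        rfl
      zero_mem' := by simp
      smul_mem' := fun c P hP => by
        have := Tendsto.const_smul hP c
        rw [← integral_smul] at this
        refine this.congr fun N => ?_
        rw [smul_comm, Finset.smul_sum]
        rfl }
  have hspan : Submodule.span ℂ (Set.range (UnitAddTorus.mFourier (d := Fin d))) ≤ Q := by
    rw [Submodule.span_le]
    rintro _ ⟨h, rfl⟩
    change Tendsto _ _ _
    simp_rw [mFourier_toTorus]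
    by_cases hh : h = 0
    · subst hh
      simp only [Pi.zero_apply, Int.cast_zero, zero_mul, Finset.sum_const_zero, expTwoPi_zero,
        Finset.sum_const, Finset.card_range, integral_const, probReal_univ, one_smul]
      refine tendsto_const_nhds.congr' ?_
      filter_upwards [eventually_ne_atTop 0] with N hN
      simp [hN]
    · rw [hμ, integral_cube_expTwoPi h hh]
      exact hx h hh
  have hdense : F ∈ (Submodule.span ℂ
      (Set.range (UnitAddTorus.mFourier (d := Fin d)))).topologicalClosure := by
    rw [UnitAddTorus.span_mFourier_closure_eq_top]
    trivial
  rw [Metric.tendsto_atTop]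
  intro ε hε
  obtain ⟨P, hPs, hPF⟩ := Metric.mem_closure_iff.1 hdense (ε / 3) (by positivity)
  obtain ⟨N₀, hN₀⟩ := Metric.tendsto_atTop.1 (hspan hPs) (ε / 3) (by positivity)
  refine ⟨N₀, fun N hN => ?_⟩
  have hpt : ∀ z, ‖F z - P z‖ ≤ dist F P := fun z => by
    rw [← dist_eq_norm]
    exact ContinuousMap.dist_apply_le_dist z
  have h1 : dist ((N : ℂ)⁻¹ • ∑ n ∈ Finset.range N, F (toTorus (x n)))
      ((N : ℂ)⁻¹ • ∑ n ∈ Finset.range N, P (toTorus (x n))) ≤ dist F P := by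
    rw [dist_eq_norm, ← smul_sub, ← Finset.sum_sub_distrib, norm_smul, norm_inv,
      Complex.norm_natCast]
    have h2 := norm_sum_le_of_le (Finset.range N)
      (f := fun n => F (toTorus (x n)) - P (toTorus (x n))) fun n _ => hpt _
    rw [Finset.sum_const, Finset.card_range, nsmul_eq_mul] at h2
    rcases Nat.eq_zero_or_pos N with rfl | hN
    · simp
    · have : (0 : ℝ) < N := Nat.cast_pos.2 hN
      rwa [inv_mul_le_iff₀ this]
  have h2 : dist (∫ y, P (toTorus y) ∂μ) (∫ y, F (toTorus y) ∂μ) ≤ dist F P := by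
    rw [dist_comm, dist_eq_norm, ← integral_sub (hint F) (hint P)]
    have := norm_integral_le_of_norm_le_const (μ := μ) (Eventually.of_forall fun y => hpt (toTorus y))
    simpa using this
  have h3 := hN₀ N hN
  have h4 := dist_triangle4 ((N : ℂ)⁻¹ • ∑ n ∈ Finset.range N, F (toTorus (x n)))
      ((N : ℂ)⁻¹ • ∑ n ∈ Finset.range N, P (toTorus (x n))) (∫ y, P (toTorus y) ∂μ)
      (∫ y, F (toTorus y) ∂μ)
  linarith

end Weyl

section AlmostEverywhere

/-- Cesàro averages of a bounded sequence vanish in the limit as soon as they do along fourth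
powers. -/
theorem tendsto_average_of_tendsto_pow_four (z : ℕ → ℂ) (hz : ∀ n, ‖z n‖ ≤ 1)
    (h : Tendsto (fun j : ℕ => ((j ^ 4 : ℕ) : ℂ)⁻¹ * ∑ n ∈ Finset.range (j ^ 4), z n) atTop
      (nhds 0)) :
    Tendsto (fun N : ℕ => (N : ℂ)⁻¹ * ∑ n ∈ Finset.range N, z n) atTop (nhds 0) := by
  set r : ℕ → ℕ := fun N => N.sqrt.sqrt with hr
  have hr1 : ∀ N, r N ^ 4 ≤ N := fun N => by
    calc r N ^ 4 = (r N ^ 2) ^ 2 := by ring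
      _ ≤ N.sqrt ^ 2 := Nat.pow_le_pow_left (Nat.sqrt_le' _) 2
      _ ≤ N := Nat.sqrt_le' _
  have hr2 : ∀ N, N ≤ (r N + 1) ^ 4 := fun N => by
    have h1 : N.sqrt + 1 ≤ (r N + 1) ^ 2 := Nat.lt_succ_sqrt' N.sqrt
    calc N ≤ (N.sqrt + 1) ^ 2 := (Nat.lt_succ_sqrt' N).le
      _ ≤ ((r N + 1) ^ 2) ^ 2 := Nat.pow_le_pow_left h1 2
      _ = _ := by ring
  have hrt : Tendsto r atTop atTop := by
    refine tendsto_atTop_mono' _ (f₁ := fun N => r N) (Eventually.of_forall fun _ => le_rfl) ?_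
    refine tendsto_atTop.2 fun b => ?_
    filter_upwards [eventually_ge_atTop ((b ^ 2) ^ 2)] with N hN
    exact Nat.le_sqrt'.2 (Nat.le_sqrt'.2 hN)
  have hlim : Tendsto (fun N => ‖((r N ^ 4 : ℕ) : ℂ)⁻¹ * ∑ n ∈ Finset.range (r N ^ 4), z n‖ +
      15 * ((r N : ℕ) : ℝ)⁻¹) atTop (nhds 0) := by
    have h1 := (h.comp hrt).norm
    have h2 := ((tendsto_inv_atTop_nhds_zero_nat (𝕜 := ℝ)).comp hrt).const_mul 15
    have := h1.add h2
    simpa using this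
  refine squeeze_zero_norm' ?_ hlim
  filter_upwards [eventually_ge_atTop 1] with N hN
  have hj : 1 ≤ r N := Nat.le_sqrt'.2 (Nat.le_sqrt'.2 (by simpa using hN))
  have h1 := hr1 N
  have h2 := hr2 N
  generalize r N = j at h1 h2 hj
  have hjR : (1 : ℝ) ≤ j := by exact_mod_cast hj
  have h1R : (j : ℝ) ^ 4 ≤ N := by exact_mod_cast h1
  have h2R : (N : ℝ) ≤ ((j : ℝ) + 1) ^ 4 := by exact_mod_cast h2
  have hNR : (0 : ℝ) < N := by exact_mod_cast hN
  rw [← Nat.add_sub_cancel' h1, Finset.sum_range_add, Nat.add_sub_cancel' h1]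
  set S := ∑ n ∈ Finset.range (j ^ 4), z n
  have htail : ‖∑ n ∈ Finset.range (N - j ^ 4), z (j ^ 4 + n)‖ ≤ (N : ℝ) - j ^ 4 := by
    refine (norm_sum_le_of_le _ fun n _ => hz _).trans ?_
    simp [Nat.cast_sub h1]
  rw [norm_mul, norm_mul, norm_inv, norm_inv, Complex.norm_natCast, Complex.norm_natCast]
  push_cast
  have hj4 : (0 : ℝ) < (j : ℝ) ^ 4 := by positivity
  calc (N : ℝ)⁻¹ * ‖S + ∑ n ∈ Finset.range (N - j ^ 4), z (j ^ 4 + n)‖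
      ≤ ((j : ℝ) ^ 4)⁻¹ * (‖S‖ + ((N : ℝ) - j ^ 4)) := by
        refine mul_le_mul ?_ ((norm_add_le _ _).trans (by gcongr)) (norm_nonneg _) (by positivity)
        exact inv_anti₀ hj4 h1R
    _ ≤ ((j : ℝ) ^ 4)⁻¹ * (‖S‖ + 15 * j ^ 3) := by
        gcongr
        nlinarith [pow_le_pow_right₀ hjR (show 2 ≤ 3 by norm_num),
          pow_le_pow_right₀ hjR (show 1 ≤ 3 by norm_num),
          pow_le_pow_right₀ hjR (show 0 ≤ 3 by norm_num)]
    _ = _ := by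
        field_simp

/-- The number of coincidences among the first `N` terms of `u`. -/
def coincidences (u : ℕ → ℤ) (N : ℕ) : ℕ :=
  ∑ m ∈ Finset.range N, ((Finset.range N).filter fun n => u m = u n).card

theorem integral_norm_sq_sum_expTwoPi (u : ℕ → ℤ) (N : ℕ) :
    ∫ ω in (0 : ℝ)..1, ‖∑ n ∈ Finset.range N, expTwoPi (u n * ω)‖ ^ 2 = coincidences u N := by
  rw [← Complex.ofReal_inj, ← intervalIntegral.integral_ofReal]
  have h1 : ∀ ω : ℝ, ((‖∑ n ∈ Finset.range N, expTwoPi (u n * ω)‖ ^ 2 : ℝ) : ℂ) =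
      ∑ m ∈ Finset.range N, ∑ n ∈ Finset.range N, expTwoPi (((u m - u n : ℤ) : ℝ) * ω) := by
    intro ω
    rw [Complex.ofReal_pow, ← Complex.mul_conj', map_sum, Finset.sum_mul_sum]
    refine Finset.sum_congr rfl fun m _ => Finset.sum_congr rfl fun n _ => ?_
    rw [conj_expTwoPi, ← expTwoPi_add]
    push_cast
    ring_nf
  simp_rw [h1]
  have hi : ∀ k : ℤ, IntervalIntegrable (fun ω : ℝ => expTwoPi (k * ω)) volume 0 1 := fun k =>
    Continuous.intervalIntegrable (by fun_prop) _ _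
  rw [intervalIntegral.integral_finsetSum fun m _ =>
    Continuous.intervalIntegrable (by fun_prop) _ _]
  simp_rw [intervalIntegral.integral_finsetSum fun n _ => hi _, integral_expTwoPi, sub_eq_zero]
  simp [coincidences, Finset.sum_boole]

theorem ae_of_ae_restrict_Ioc_of_periodic {P : ℝ → Prop} (hP : ∀ (ω : ℝ) (k : ℤ), P (ω + k) → P ω)
    (h : ∀ᵐ ω ∂(volume.restrict (Set.Ioc (0 : ℝ) 1)), P ω) : ∀ᵐ ω : ℝ, P ω := by
  rw [ae_restrict_iff' measurableSet_Ioc] at h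
  have h1 : ∀ᵐ ω : ℝ, ∀ k : ℤ, ω + k ∈ Set.Ioc (0 : ℝ) 1 → P (ω + k) := ae_all_iff.2 fun k =>
    (measurePreserving_add_right volume (k : ℝ)).quasiMeasurePreserving.ae h
  filter_upwards [h1] with ω hω
  refine hP ω (1 - ⌈ω⌉) (hω _ ?_)
  have := Int.ceil_lt_add_one ω
  have := Int.le_ceil ω
  push_cast
  constructor <;> linarith

theorem ae_tendsto_average_expTwoPi (u : ℕ → ℤ) (C : ℝ)
    (hu : ∀ N, (coincidences u N : ℝ) ^ 2 ≤ C ^ 2 * N ^ 3) :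
    ∀ᵐ ω : ℝ, Tendsto (fun N : ℕ => (N : ℂ)⁻¹ * ∑ n ∈ Finset.range N, expTwoPi (u n * ω)) atTop
      (nhds 0) := by
  refine ae_of_ae_restrict_Ioc_of_periodic (fun ω k h => ?_) ?_
  · refine h.congr fun N => ?_
    congr 1
    refine Finset.sum_congr rfl fun n _ => ?_
    rw [mul_add, expTwoPi_add, ← Int.cast_mul, expTwoPi_intCast, mul_one]
  set μ := (volume : Measure ℝ).restrict (Set.Ioc 0 1)
  set V : ℕ → ℝ → ℂ := fun N ω => (N : ℂ)⁻¹ * ∑ n ∈ Finset.range N, expTwoPi (u n * ω) with hV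
  have hVc : ∀ N, Continuous (V N) := fun N => by fun_prop
  have hint : ∀ j : ℕ, ∫⁻ ω, ENNReal.ofReal (‖V (j ^ 4) ω‖ ^ 2) ∂μ ≤
      ENNReal.ofReal (|C| * ((j : ℝ) ^ 2)⁻¹) := fun j => by
    rw [← ofReal_integral_eq_lintegral_ofReal]
    · refine ENNReal.ofReal_le_ofReal ?_
      rw [← intervalIntegral.integral_of_le zero_le_one]
      have h1 : ∀ ω, ‖V (j ^ 4) ω‖ ^ 2 = ((j : ℝ) ^ 8)⁻¹ *
          ‖∑ n ∈ Finset.range (j ^ 4), expTwoPi (u n * ω)‖ ^ 2 := fun ω => by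
        rw [hV]
        simp only [norm_mul, norm_inv, Complex.norm_natCast, mul_pow, inv_pow]
        push_cast
        ring
      simp_rw [h1]
      rw [intervalIntegral.integral_const_mul, integral_norm_sq_sum_expTwoPi]
      have h2 := hu (j ^ 4)
      have h3 : (coincidences u (j ^ 4) : ℝ) ≤ |C| * (j : ℝ) ^ 6 := by
        refine le_of_sq_le_sq ?_ (by positivity)
        rw [mul_pow, sq_abs]
        refine h2.trans (le_of_eq ?_)
        push_cast
        ring
      rcases Nat.eq_zero_or_pos j with rfl | hj
      · simp
      have hjR : (0 : ℝ) < j := by exact_mod_cast hj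
      calc _ ≤ ((j : ℝ) ^ 8)⁻¹ * (|C| * (j : ℝ) ^ 6) := by gcongr
        _ = _ := by field_simp
    · exact ((hVc _).norm.pow 2).integrableOn_Ioc
    · exact Eventually.of_forall fun ω => by positivity
  have hsum : ∫⁻ ω, ∑' j : ℕ, ENNReal.ofReal (‖V (j ^ 4) ω‖ ^ 2) ∂μ ≠ ⊤ := by
    rw [lintegral_tsum fun j => by
      have := hVc (j ^ 4)
      exact (by fun_prop : Measurable _).aemeasurable]
    refine ne_top_of_le_ne_top ?_ (ENNReal.tsum_le_tsum hint)
    have h1 : Summable fun j : ℕ => |C| * ((j : ℝ) ^ 2)⁻¹ :=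
      (Real.summable_nat_pow_inv.2 one_lt_two).mul_left _
    rw [← ENNReal.ofReal_tsum_of_nonneg (fun j => by positivity) h1]
    exact ENNReal.ofReal_ne_top
  have hae := ae_lt_top' (μ := μ) (by
    refine AEMeasurable.tsum fun j => ?_
    have := hVc (j ^ 4)
    exact (by fun_prop : Measurable _).aemeasurable) hsum
  filter_upwards [hae] with ω hω
  refine tendsto_average_of_tendsto_pow_four _ (fun n => (norm_expTwoPi _).le) ?_
  have h1 := ENNReal.tendsto_atTop_zero_of_tsum_ne_top hω.ne
  have h2 := (ENNReal.tendsto_toReal ENNReal.zero_ne_top).comp h1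
  simp only [Function.comp_def, ENNReal.toReal_zero] at h2
  have h3 := h2.sqrt
  rw [Real.sqrt_zero] at h3
  refine tendsto_zero_iff_norm_tendsto_zero.2 (h3.congr fun j => ?_)
  rw [ENNReal.toReal_ofReal (by positivity), Real.sqrt_sq (norm_nonneg _)]

end AlmostEverywhere

section Main

variable {d : ℕ}

theorem coincidences_le_sum (u : ℕ → ℤ) (N : ℕ) :
    coincidences u N ≤ ∑ k ∈ Finset.range N,
      2 * ((Finset.range N).filter fun m => u (m + k) = u m).card := by
  set Z : ℕ → Finset ℕ := fun k => (Finset.range N).filter fun m => u (m + k) = u m with hZ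
  have h1 : coincidences u N =
      ((Finset.range N).sigma fun m => (Finset.range N).filter fun n => u m = u n).card := by
    rw [Finset.card_sigma, coincidences]
  rw [h1]
  have hsub : ((Finset.range N).sigma fun m => (Finset.range N).filter fun n => u m = u n) ⊆
      (Finset.range N).biUnion fun k => ((Z k).image fun m => (⟨m, m + k⟩ : Σ _ : ℕ, ℕ)) ∪
        (Z k).image fun m => ⟨m + k, m⟩ := by
    rintro ⟨m, n⟩ hmn
    simp only [Finset.mem_sigma, Finset.mem_range, Finset.mem_filter] at hmn
    obtain ⟨hm, hn, hu⟩ := hmn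
    simp only [Finset.mem_biUnion, Finset.mem_range, Finset.mem_union, Finset.mem_image, hZ,
      Finset.mem_filter]
    rcases le_total m n with h | h
    · refine ⟨n - m, by omega, Or.inl ⟨m, ⟨hm, ?_⟩, ?_⟩⟩ <;> rw [Nat.add_sub_cancel' h]
      exact hu.symm
    · refine ⟨m - n, by omega, Or.inr ⟨n, ⟨hn, ?_⟩, ?_⟩⟩ <;> rw [Nat.add_sub_cancel' h]
      exact hu
  refine (Finset.card_le_card hsub).trans (Finset.card_biUnion_le.trans
    (Finset.sum_le_sum fun k _ => (Finset.card_union_le _ _).trans ?_))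
  rw [two_mul]
  exact add_le_add Finset.card_image_le Finset.card_image_le

theorem coincidences_sq_le (u : ℕ → ℤ) (K : ℕ)
    (hu : ∀ k ≥ 1, ∀ N : ℕ,
      ((Finset.range N).filter fun m => u (m + k) = u m).card ^ 2 ≤ K * N) (N : ℕ) :
    (coincidences u N : ℝ) ^ 2 ≤ (2 * (1 + √K)) ^ 2 * N ^ 3 := by
  have hk : ∀ k ∈ Finset.range N,
      ((2 * ((Finset.range N).filter fun m => u (m + k) = u m).card : ℕ) : ℝ) ≤
        (if k = 0 then 2 * (N : ℝ) else 0) + 2 * (√K * √N) := fun k _ => by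
    push_cast
    split_ifs with h0
    · have h1 : (((Finset.range N).filter fun m => u (m + k) = u m).card : ℝ) ≤ N := by
        exact_mod_cast (Finset.card_filter_le _ _).trans (Finset.card_range N).le
      have : 0 ≤ √K * √N := by positivity
      linarith
    · have h1 := hu k (Nat.one_le_iff_ne_zero.2 h0) N
      have h2 : (((Finset.range N).filter fun m => u (m + k) = u m).card : ℝ) ≤ √K * √N := by
        rw [← Real.sqrt_mul (Nat.cast_nonneg _)]
        exact Real.le_sqrt_of_sq_le (by exact_mod_cast h1)
      linarith
  rcases Nat.eq_zero_or_pos N with rfl | hN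
  · simp [coincidences]
  have hNR : (1 : ℝ) ≤ N := by exact_mod_cast hN
  have hsq : √(N : ℝ) ^ 2 = N := Real.sq_sqrt (by positivity)
  have hs1 : 1 ≤ √(N : ℝ) := Real.one_le_sqrt.2 hNR
  have h1 : (coincidences u N : ℝ) ≤ 2 * (1 + √K) * (N * √N) := by
    calc (coincidences u N : ℝ) ≤ ∑ k ∈ Finset.range N,
          ((2 * ((Finset.range N).filter fun m => u (m + k) = u m).card : ℕ) : ℝ) := by
            exact_mod_cast coincidences_le_sum u N
      _ ≤ ∑ k ∈ Finset.range N, ((if k = 0 then 2 * (N : ℝ) else 0) + 2 * (√K * √N)) :=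
          Finset.sum_le_sum hk
      _ = 2 * N * 1 + N * (2 * (√K * √N)) := by
          rw [Finset.sum_add_distrib, Finset.sum_ite_eq', if_pos (Finset.mem_range.2 hN)]
          simp
      _ ≤ 2 * N * √N + N * (2 * (√K * √N)) := by gcongr
      _ = _ := by ring
  calc (coincidences u N : ℝ) ^ 2 ≤ (2 * (1 + √K) * (N * √N)) ^ 2 := by gcongr
    _ = (2 * (1 + √K)) ^ 2 * (N ^ 2 * √N ^ 2) := by ring
    _ = _ := by rw [hsq]; ring

theorem linRec_pow_sub_one (A : Matrix (Fin d) (Fin d) ℤ) (h w : Fin d → ℤ) (k m : ℕ) :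
    linRec A h ((A ^ k - 1) *ᵥ w) m = linRec A h w (m + k) - linRec A h w m := by
  simp only [linRec, Matrix.sub_mulVec, Matrix.mulVec_sub, dotProduct_sub, Matrix.one_mulVec,
    Matrix.mulVec_mulVec, ← pow_add]

theorem ae_tendsto_average_linRec {A : Matrix (Fin d) (Fin d) ℤ} (hA : A.det ≠ 0)
    (hM : RatioNondegenerate (A.map (Int.castRingHom ℂ)))
    (hroot : ∀ θ, (A.map (Int.castRingHom ℂ)).charpoly.IsRoot θ → ¬ IsRootOfUnity θ)
    {w : Fin d → ℤ} (hw : (krylov A w).det ≠ 0) {h : Fin d → ℤ} (hh : h ≠ 0) :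
    ∀ᵐ ω : ℝ, Tendsto (fun N : ℕ =>
      (N : ℂ)⁻¹ * ∑ n ∈ Finset.range N, expTwoPi (linRec A h w n * ω)) atTop (nhds 0) := by
  obtain ⟨K, hK⟩ := exists_sq_card_zeros_le A hA
  refine ae_tendsto_average_expTwoPi _ _ (coincidences_sq_le _ K fun k hk N => ?_)
  have := hK h _ (hM.noZeroProgression hA hroot hw hh hk) N
  simpa only [linRec_pow_sub_one, sub_eq_zero] using this

/-- If the exponential averages along `u` tend to zero almost everywhere, then `u` takes no value
with positive density; in particular `u` is not constant on any progression `kℕ`. -/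
theorem not_forall_eq_of_ae_tendsto {u : ℕ → ℤ}
    (hu : ∀ᵐ ω : ℝ, Tendsto (fun N : ℕ =>
      (N : ℂ)⁻¹ * ∑ n ∈ Finset.range N, expTwoPi (u n * ω)) atTop (nhds 0))
    {k : ℕ} (hk : 1 ≤ k) : ¬ ∀ n, u (k * n) = u 0 := by
  intro hcon
  set F : ℕ → ℝ → ℂ := fun N ω =>
    (N : ℂ)⁻¹ * ∑ n ∈ Finset.range N, expTwoPi (((u n - u 0 : ℤ) : ℝ) * ω) with hF
  have hFeq : ∀ N ω, F N ω = expTwoPi (-(u 0 * ω)) *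
      ((N : ℂ)⁻¹ * ∑ n ∈ Finset.range N, expTwoPi (u n * ω)) := fun N ω => by
    rw [hF]
    simp only [Finset.mul_sum]
    refine Finset.sum_congr rfl fun n _ => ?_
    rw [show ((u n - u 0 : ℤ) : ℝ) * ω = -(u 0 * ω) + u n * ω by push_cast; ring, expTwoPi_add]
    ring
  have hFc : ∀ N, Continuous (F N) := fun N => by fun_prop
  have hlim : Tendsto (fun N => ∫ ω in (0 : ℝ)..1, F N ω) atTop
      (nhds (∫ _ in (0 : ℝ)..1, (0 : ℂ))) := by
    refine intervalIntegral.tendsto_integral_filter_of_dominated_convergence (fun _ => 1)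
      (Eventually.of_forall fun N => (hFc N).aestronglyMeasurable) ?_ (by simp) ?_
    · refine Eventually.of_forall fun N => Eventually.of_forall fun ω _ => ?_
      rw [hF]
      simp only [norm_mul, norm_inv, Complex.norm_natCast]
      have h2 := norm_sum_le_of_le (Finset.range N)
        (f := fun n => expTwoPi (((u n - u 0 : ℤ) : ℝ) * ω)) fun n _ => (norm_expTwoPi _).le
      rw [Finset.sum_const, Finset.card_range, nsmul_eq_mul, mul_one] at h2
      rcases Nat.eq_zero_or_pos N with rfl | hN
      · simp
      · have : (0 : ℝ) < N := Nat.cast_pos.2 hN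
        rwa [inv_mul_le_iff₀ this, mul_one]
    · filter_upwards [hu] with ω hω _
      have := hω.const_mul (expTwoPi (-(u 0 * ω)))
      rw [mul_zero] at this
      exact this.congr fun N => (hFeq N ω).symm
  have hval : ∀ N, ∫ ω in (0 : ℝ)..1, F N ω =
      (N : ℂ)⁻¹ * ((Finset.range N).filter fun n => u n = u 0).card := fun N => by
    rw [hF]
    simp only
    rw [intervalIntegral.integral_const_mul, intervalIntegral.integral_finsetSum fun m _ =>
      Continuous.intervalIntegrable (by fun_prop) _ _]
    simp_rw [integral_expTwoPi, sub_eq_zero, Finset.sum_boole]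
  rw [intervalIntegral.integral_zero] at hlim
  have hsub : Tendsto (fun M : ℕ => k * (M + 1)) atTop atTop :=
    tendsto_atTop_mono (fun M => (Nat.le_succ M).trans (Nat.le_mul_of_pos_left _ hk)) tendsto_id
  have hnorm := (hlim.comp hsub).norm
  rw [norm_zero] at hnorm
  have hge : ∀ M : ℕ, (k : ℝ)⁻¹ ≤ ‖∫ ω in (0 : ℝ)..1, F (k * (M + 1)) ω‖ := fun M => by
    rw [hval, norm_mul, norm_inv, Complex.norm_natCast, Complex.norm_natCast]
    have hcard : M + 1 ≤ ((Finset.range (k * (M + 1))).filter fun n => u n = u 0).card := by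
      have hi : Function.Injective fun n => k * n := fun a b hab =>
        Nat.eq_of_mul_eq_mul_left hk hab
      have hc := Finset.card_image_of_injective (Finset.range (M + 1)) hi
      rw [Finset.card_range] at hc
      refine hc.symm.le.trans (Finset.card_le_card fun n hn => ?_)
      obtain ⟨j, hj, rfl⟩ := Finset.mem_image.1 hn
      rw [Finset.mem_filter, Finset.mem_range]
      exact ⟨Nat.mul_lt_mul_of_pos_left (Finset.mem_range.1 hj) hk, hcon j⟩
    have hkR : (0 : ℝ) < k := by exact_mod_cast hk
    have hcardR : ((M : ℝ) + 1) ≤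
        ((Finset.range (k * (M + 1))).filter fun n => u n = u 0).card := by exact_mod_cast hcard
    push_cast
    calc (k : ℝ)⁻¹ = (k * ((M : ℝ) + 1))⁻¹ * (M + 1) := by field_simp
      _ ≤ _ := by gcongr
  have := ge_of_tendsto' hnorm hge
  have hkR : (0 : ℝ) < (k : ℝ)⁻¹ := inv_pos.2 (by exact_mod_cast hk)
  linarith

theorem exists_common_denominator (v : Fin d → ℚ) :
    ∃ q : ℕ, q ≠ 0 ∧ ∃ w : Fin d → ℤ, ∀ i, (v i : ℝ) = (q : ℝ)⁻¹ * w i := by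
  have hq : ∏ i, (v i).den ≠ 0 := Finset.prod_ne_zero_iff.2 fun i _ => (v i).den_nz
  refine ⟨∏ i, (v i).den, hq, ?_⟩
  have : ∀ i, ∃ z : ℤ, (v i : ℝ) = ((∏ i, (v i).den : ℕ) : ℝ)⁻¹ * z := fun i => by
    obtain ⟨c, hc⟩ := Finset.dvd_prod_of_mem (fun i => (v i).den) (Finset.mem_univ i)
    refine ⟨(v i).num * c, ?_⟩
    have hden : ((v i).den : ℝ) ≠ 0 := Nat.cast_ne_zero.2 (v i).den_nz
    have hc0 : (c : ℝ) ≠ 0 := Nat.cast_ne_zero.2 (by rintro rfl; exact hq (by rw [hc, mul_zero]))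
    rw [hc, Rat.cast_def]
    push_cast
    field_simp
  choose w hw using this
  exact ⟨w, hw⟩

theorem linRec_smul {R : Type*} [CommRing R] (B : Matrix (Fin d) (Fin d) R) (h x : Fin d → R)
    (c : R) (n : ℕ) : linRec B h (c • x) n = c * linRec B h x n := by
  rw [linRec, Matrix.mulVec_smul, dotProduct_smul, smul_eq_mul, linRec]

theorem linearIndependent_iff_det_krylov (A : Matrix (Fin d) (Fin d) ℤ) {c : ℝ} (hc : c ≠ 0)
    (w : Fin d → ℤ) :
    LinearIndependent ℝ (fun i : Fin d =>
        (A.map (Int.cast : ℤ → ℝ)) ^ (i : ℕ) *ᵥ (c • fun j => (w j : ℝ))) ↔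
      (krylov A w).det ≠ 0 := by
  change LinearIndependent ℝ (krylov (A.map (Int.castRingHom ℝ))
    (c • (Int.castRingHom ℝ ∘ w))).row ↔ _
  rw [Matrix.linearIndependent_rows_iff_isUnit, Matrix.isUnit_iff_isUnit_det, isUnit_iff_ne_zero,
    not_iff_not, ← map_eq_zero_iff (Int.castRingHom ℝ) Int.cast_injective, ← det_krylov_map,
    det_krylov_eq_zero_iff, det_krylov_eq_zero_iff]
  simp only [linRec_smul, mul_eq_zero, hc, false_or]

theorem ae_comp_mul {P : ℝ → Prop} (h : ∀ᵐ ω : ℝ, P ω) {c : ℝ} (hc : c ≠ 0) :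
    ∀ᵐ ω : ℝ, P (c * ω) :=
  (Measure.quasiMeasurePreserving_smul (μ := (volume : Measure ℝ)) hc).ae h

theorem ae_udMod1_iff (A : Matrix (Fin d) (Fin d) ℤ) {c : ℝ} (hc : c ≠ 0) (w : Fin d → ℤ) :
    (∀ᵐ ω : ℝ, UDMod1 fun n =>
        (A.map (Int.cast : ℤ → ℝ)) ^ n *ᵥ (ω • (c • fun j => (w j : ℝ)))) ↔
      ∀ h : Fin d → ℤ, h ≠ 0 → ∀ᵐ ω : ℝ, Tendsto (fun N : ℕ =>
        (N : ℂ)⁻¹ * ∑ n ∈ Finset.range N, expTwoPi (linRec A h w n * ω)) atTop (nhds 0) := by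
  have key : ∀ (h : Fin d → ℤ) (ω : ℝ) (n : ℕ), ∑ i, (h i : ℝ) *
      ((A.map (Int.cast : ℤ → ℝ)) ^ n *ᵥ (ω • (c • fun j => (w j : ℝ)))) i =
        linRec A h w n * (c * ω) := fun h ω n => by
    have h1 := linRec_map (Int.castRingHom ℝ) A h w n
    have h2 := linRec_smul (A.map (Int.castRingHom ℝ)) (Int.castRingHom ℝ ∘ h)
      (Int.castRingHom ℝ ∘ w) (c * ω) n
    rw [h1] at h2
    rw [smul_smul, mul_comm ω, mul_comm _ (c * ω)]
    exact h2
  constructor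
  · intro H h hh
    have h1 := ae_comp_mul H (inv_ne_zero hc)
    filter_upwards [h1] with ω hω
    have h2 := hω.tendsto_expTwoPi h hh
    simp_rw [key, mul_inv_cancel_left₀ hc] at h2
    exact h2
  · intro H
    have h1 : ∀ᵐ ω : ℝ, ∀ h : Fin d → ℤ, h ≠ 0 → Tendsto (fun N : ℕ =>
        (N : ℂ)⁻¹ * ∑ n ∈ Finset.range N, expTwoPi (linRec A h w n * (c * ω))) atTop
          (nhds 0) := by
      refine ae_all_iff.2 fun h => ?_
      by_cases hh : h = 0
      · exact Eventually.of_forall fun ω h0 => absurd hh h0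
      · filter_upwards [ae_comp_mul (H h hh) hc] with ω hω _ using hω
    filter_upwards [h1] with ω hω
    refine udMod1_of_tendsto_expTwoPi fun h hh => ?_
    simp_rw [key]
    exact hω h hh

end Main


theorem stmt0 (d : ℕ) (hd : 1 ≤ d) (A : Matrix (Fin d) (Fin d) ℤ) (hA : A.det ≠ 0)
    (v : Fin d → ℚ) :
    (∀ᵐ ω ∂(volume : Measure ℝ),
        UDMod1 (fun n => ((A.map (Int.cast : ℤ → ℝ)) ^ n) *ᵥ (ω • fun i => ((v i : ℝ))))) ↔
      ((¬ ∃ θ η : ℂ, ((A.charpoly).map (Int.castRingHom ℂ)).IsRoot θ ∧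
          ((A.charpoly).map (Int.castRingHom ℂ)).IsRoot η ∧ θ ≠ η ∧ IsRootOfUnity (θ / η)) ∧
        (¬ ∃ θ : ℂ, ((A.charpoly).map (Int.castRingHom ℂ)).IsRoot θ ∧ IsRootOfUnity θ) ∧
        LinearIndependent ℝ
          (fun i : Fin d => ((A.map (Int.cast : ℤ → ℝ)) ^ (i : ℕ)) *ᵥ fun j => ((v j : ℝ)))) := by
  obtain ⟨q, hq, w, hw⟩ := exists_common_denominator v
  have hc : (q : ℝ)⁻¹ ≠ 0 := inv_ne_zero (Nat.cast_ne_zero.2 hq)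
  have hv : (fun i => (v i : ℝ)) = (q : ℝ)⁻¹ • fun i => (w i : ℝ) := funext hw
  rw [hv, linearIndependent_iff_det_krylov A hc w, ae_udMod1_iff A hc w, ← Matrix.charpoly_map]
  constructor
  · intro H
    have hcond : RatioNondegenerate (A.map (Int.castRingHom ℂ)) ∧
        (∀ θ, (A.map (Int.castRingHom ℂ)).charpoly.IsRoot θ → ¬ IsRootOfUnity θ) ∧
        (krylov A w).det ≠ 0 := by
      by_contra hcon
      obtain ⟨h, hh, k, hk, hconst⟩ := exists_linRec_constant hcon
      exact not_forall_eq_of_ae_tendsto (H h hh) hk hconst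
    refine ⟨?_, ?_, hcond.2.2⟩
    · rintro ⟨θ, η, hθ, hη, hne, hr⟩
      exact hne (hcond.1 θ η hθ hη hr)
    · rintro ⟨θ, hθ, hr⟩
      exact hcond.2.1 θ hθ hr
  · rintro ⟨h1, h2, h3⟩ h hh
    refine ae_tendsto_average_linRec hA (fun θ η hθ hη hr => ?_) (fun θ hθ hr => h2 ⟨θ, hθ, hr⟩)
      h3 hh
    by_contra hne
    exact h1 ⟨θ, η, hθ, hη, hne, hr⟩
end

section
/- Let α_0, …, α_{d−1} ∈ ℤ with α_0 ≠ 0, and suppose the recurrence relation u_n = Σ_{i=0}^{d−1} α_i u_{n−d+i} is degenerate, i.e. its companion polynomial x^d − Σ_{i=0}^{d−1} α_i x^i has two distinct complex roots whose ratio is a root of unity. Then there exists a sequence of integers (z_n)_{n≥0}, not identically zero, which satisfies this recurrence relation and for which there exists an integer k ≥ 2 with z_{kn} = 0 for all n ∈ ℕ. -/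
open Polynomial

/-- The companion polynomial `x^d - ∑_{i<d} αᵢ x^i` of the recurrence relation
`u_n = ∑_{i<d} αᵢ u_{n-d+i}`, viewed as a complex polynomial. -/
noncomputable def companionPoly (d : ℕ) (α : Fin d → ℤ) : Polynomial ℂ :=
  X ^ d - ∑ i : Fin d, C ((α i : ℂ)) * X ^ (i : ℕ)

/-- The powers of a root of the companion polynomial satisfy the recurrence relation. -/
theorem pow_add_eq_sum_of_isRoot_companionPoly {d : ℕ} {α : Fin d → ℤ} {x : ℂ}
    (hx : (companionPoly d α).IsRoot x) (n : ℕ) :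
    x ^ (n + d) = ∑ i : Fin d, (α i : ℂ) * x ^ (n + (i : ℕ)) := by
  have h : x ^ d = ∑ i : Fin d, (α i : ℂ) * x ^ (i : ℕ) := by
    simpa [companionPoly, Polynomial.IsRoot, eval_finsetSum, sub_eq_zero] using hx
  rw [pow_add, h, Finset.mul_sum]
  exact Finset.sum_congr rfl fun i _ => by ring

/-- A rational sequence satisfying a recurrence relation with integer coefficients becomes an
integer sequence after multiplication by a suitable nonzero integer. -/
theorem exists_int_mul_eq_intCast_of_recurrence {d : ℕ} {α : Fin d → ℤ} {w : ℕ → ℚ}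
    (hw : ∀ n, w (n + d) = ∑ i : Fin d, (α i : ℚ) * w (n + (i : ℕ))) :
    ∃ D : ℤ, D ≠ 0 ∧ ∀ n, ∃ m : ℤ, (m : ℚ) = D * w n := by
  obtain ⟨D, hD⟩ := IsLocalization.exist_integer_multiples_of_finset (nonZeroDivisors ℤ)
    ((Finset.range d).image w)
  refine ⟨D, nonZeroDivisors.coe_ne_zero D, fun n => ?_⟩
  induction n using Nat.strong_induction_on with
  | _ n ih =>
    rcases lt_or_ge n d with hn | hn
    · obtain ⟨m, hm⟩ := hD (w n) (Finset.mem_image_of_mem w (Finset.mem_range.2 hn))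
      exact ⟨m, by simpa [Algebra.smul_def] using hm⟩
    · obtain ⟨k, rfl⟩ := Nat.exists_eq_add_of_le' hn
      choose m hm using fun i : Fin d => ih (k + (i : ℕ)) (by omega)
      refine ⟨∑ i, α i * m i, ?_⟩
      rw [hw, Finset.mul_sum]
      push_cast
      exact Finset.sum_congr rfl fun i _ => by rw [hm]; ring

theorem stmt2 (d : ℕ) (hd : 1 ≤ d) (α : Fin d → ℤ) (hα : α ⟨0, hd⟩ ≠ 0)
    (hdeg : ∃ lam mu : ℂ, (companionPoly d α).IsRoot lam ∧ (companionPoly d α).IsRoot mu ∧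
      lam ≠ mu ∧ ∃ n : ℕ, 0 < n ∧ (lam / mu) ^ n = 1) :
    ∃ z : ℕ → ℤ, (¬ ∀ n : ℕ, z n = 0) ∧
      (∀ n : ℕ, z (n + d) = ∑ i : Fin d, α i * z (n + (i : ℕ))) ∧
      ∃ k : ℕ, 2 ≤ k ∧ ∀ n : ℕ, z (k * n) = 0 := by
  obtain ⟨lam, mu, hlam, hmu, hne, k, hk, hpow⟩ := hdeg
  have hmu0 : mu ≠ 0 := by
    rintro rfl
    simp [hk.ne'] at hpow
  have hk_eq : lam ^ k = mu ^ k := by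
    rwa [div_pow, div_eq_one_iff_eq (pow_ne_zero k hmu0)] at hpow
  have hk2 : 2 ≤ k := by
    by_contra! h
    obtain rfl : k = 1 := by omega
    exact hne (by simpa using hk_eq)
  obtain ⟨f, hf⟩ : ∃ f : Module.Dual ℚ ℂ, f (lam - mu) ≠ 0 := by
    by_contra! h
    exact hne (sub_eq_zero.1 ((Module.forall_dual_apply_eq_zero_iff ℚ _).1 h))
  have hw : ∀ n, f (lam ^ (n + d) - mu ^ (n + d)) =
      ∑ i : Fin d, (α i : ℚ) * f (lam ^ (n + (i : ℕ)) - mu ^ (n + (i : ℕ))) := by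
    intro n
    rw [pow_add_eq_sum_of_isRoot_companionPoly hlam, pow_add_eq_sum_of_isRoot_companionPoly hmu,
      ← Finset.sum_sub_distrib, map_sum]
    refine Finset.sum_congr rfl fun i _ => ?_
    rw [← mul_sub, ← zsmul_eq_mul, map_zsmul, zsmul_eq_mul]
  obtain ⟨D, hD, hz⟩ :=
    exists_int_mul_eq_intCast_of_recurrence (w := fun n => f (lam ^ n - mu ^ n)) hw
  choose z hz using hz
  refine ⟨z, fun h => ?_, fun n => ?_, k, hk2, fun n => ?_⟩
  · have h1 := hz 1
    rw [h 1, pow_one, pow_one, Int.cast_zero, eq_comm, mul_eq_zero] at h1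
    exact h1.elim (Int.cast_ne_zero.2 hD) hf
  · rw [← Int.cast_inj (α := ℚ), hz, hw, Finset.mul_sum]
    push_cast
    exact Finset.sum_congr rfl fun i _ => by rw [hz]; ring
  · rw [← Int.cast_inj (α := ℚ), hz, pow_mul, pow_mul, hk_eq]
    simp
end

section
/- Let A ∈ M_d(ℤ) be non-singular and let v ∈ ℚ^d. If (A^n ω v)_{n≥0} is uniformly distributed modulo 1 for Lebesgue-almost every ω ∈ ℝ, then for every integer k ≥ 1 and every ℓ ∈ ℕ, the sequence (A^{kn+ℓ} ω v)_{n≥0} is also uniformly distributed modulo 1 for Lebesgue-almost every ω ∈ ℝ. -/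
open MeasureTheory Filter Matrix

/-- The character `y ↦ exp (2 π i h · y)` of `ℝ^d`. -/
noncomputable def torusChar {d : ℕ} (h : Fin d → ℤ) (y : Fin d → ℝ) : ℂ :=
  Complex.exp (2 * Real.pi * Complex.I * (((fun i => (h i : ℝ)) ⬝ᵥ y : ℝ) : ℂ))

section TorusChar

variable {d : ℕ}

lemma continuous_torusChar (h : Fin d → ℤ) : Continuous (torusChar h) := by
  unfold torusChar dotProduct
  fun_prop

lemma norm_torusChar (h : Fin d → ℤ) (y : Fin d → ℝ) : ‖torusChar h y‖ = 1 := by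
  have := Complex.norm_exp_ofReal_mul_I (2 * Real.pi * ((fun i => (h i : ℝ)) ⬝ᵥ y))
  rw [← this, torusChar]
  congr 2
  push_cast
  ring

lemma torusChar_zero (y : Fin d → ℝ) : torusChar 0 y = 1 := by
  simp [torusChar, dotProduct]

lemma torusChar_apply_zero (h : Fin d → ℤ) : torusChar h 0 = 1 := by
  simp [torusChar]

lemma torusChar_sub (h g : Fin d → ℤ) (y : Fin d → ℝ) :
    torusChar (h - g) y = torusChar h y * (starRingEnd ℂ) (torusChar g y) := by
  rw [torusChar, torusChar, torusChar, ← Complex.exp_conj, ← Complex.exp_add]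
  congr 1
  have : (fun i => (((h - g) i : ℤ) : ℝ)) = (fun i => (h i : ℝ)) - fun i => (g i : ℝ) := by
    ext i; simp
  rw [this, sub_dotProduct]
  simp only [map_mul, Complex.conj_I, Complex.conj_ofReal, Complex.ofReal_sub, map_ofNat]
  ring

lemma torusChar_eq_prod (h : Fin d → ℤ) (y : Fin d → ℝ) :
    torusChar h y = ∏ i, Complex.exp (2 * Real.pi * Complex.I * h i * y i) := by
  rw [torusChar, ← Complex.exp_sum]
  congr 1
  simp only [dotProduct, Complex.ofReal_sum, Finset.mul_sum]
  refine Finset.sum_congr rfl fun i _ => ?_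
  push_cast
  ring

lemma mFourier_coe_eq_torusChar (h : Fin d → ℤ) (y : Fin d → ℝ) :
    UnitAddTorus.mFourier h (fun i => ((y i : ℝ) : UnitAddCircle)) = torusChar h y := by
  rw [torusChar_eq_prod]
  simp [UnitAddTorus.mFourier, fourier_coe_apply, -fourier_apply]

lemma torusChar_periodic (h : Fin d → ℤ) (y : Fin d → ℝ) (k : Fin d → ℤ) :
    torusChar h (y + fun i => (k i : ℝ)) = torusChar h y := by
  rw [← mFourier_coe_eq_torusChar, ← mFourier_coe_eq_torusChar]
  congr 1
  ext i
  simp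

lemma integral_torusChar {h : Fin d → ℤ} (hh : h ≠ 0) :
    ∫ y in Set.Icc (0 : Fin d → ℝ) 1, torusChar h y = 0 := by
  obtain ⟨j, hj⟩ := Function.ne_iff.1 hh
  rw [← Set.pi_univ_Icc, volume_pi, Measure.restrict_pi_pi]
  simp_rw [torusChar_eq_prod]
  rw [integral_fintype_prod_eq_prod
    (f := fun i (t : ℝ) => Complex.exp (2 * Real.pi * Complex.I * h i * t))]
  refine Finset.prod_eq_zero (Finset.mem_univ j) ?_
  have hc : 2 * Real.pi * Complex.I * h j ≠ 0 := by
    simpa [Real.pi_ne_zero] using hj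
  rw [integral_Icc_eq_integral_Ioc, ← intervalIntegral.integral_of_le (by simp)]
  rw [integral_exp_mul_complex hc]
  have : Complex.exp (2 * Real.pi * Complex.I * h j) = 1 :=
    Complex.exp_eq_one_iff.2 ⟨h j, by ring⟩
  simp [this]

lemma integral_torusChar_zero :
    ∫ y in Set.Icc (0 : Fin d → ℝ) 1, torusChar 0 y = 1 := by
  simp [torusChar_zero, measureReal_def, Real.volume_Icc_pi]

lemma torusChar_mulVec (A : Matrix (Fin d) (Fin d) ℤ) (h : Fin d → ℤ) (y : Fin d → ℝ) (n : ℕ) :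
    torusChar h (((A.map (Int.cast : ℤ → ℝ)) ^ n) *ᵥ y) = torusChar (h ᵥ* A ^ n) y := by
  have hpow : (A.map (Int.cast : ℤ → ℝ)) ^ n = (A ^ n).map (Int.cast : ℤ → ℝ) :=
    (map_pow (Int.castRingHom ℝ).mapMatrix A n).symm
  have hvec : (fun i => (((h ᵥ* A ^ n) i : ℤ) : ℝ)) =
      (fun i => (h i : ℝ)) ᵥ* (A ^ n).map (Int.cast : ℤ → ℝ) := by
    ext i
    exact RingHom.map_vecMul (Int.castRingHom ℝ) (A ^ n) h i
  rw [torusChar, torusChar, hpow, hvec, dotProduct_mulVec]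

end TorusChar

section Weyl

variable {d : ℕ}

/-- A continuous `ℤ^d`-periodic function factors through the torus. -/
lemma exists_continuousMap_torus {f : (Fin d → ℝ) → ℂ} (hf : Continuous f)
    (hper : ∀ (y : Fin d → ℝ) (k : Fin d → ℤ), f (y + fun i => (k i : ℝ)) = f y) :
    ∃ F : C(UnitAddTorus (Fin d), ℂ), ∀ y, F (fun i => ((y i : ℝ) : UnitAddCircle)) = f y := by
  have hq : IsOpenQuotientMap (Pi.map fun (_ : Fin d) (t : ℝ) => (t : UnitAddCircle)) :=
    IsOpenQuotientMap.piMap fun _ => QuotientAddGroup.isOpenQuotientMap_mk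
  have hfac : ∀ a b, (Pi.map fun (_ : Fin d) (t : ℝ) => (t : UnitAddCircle)) a =
      (Pi.map fun (_ : Fin d) (t : ℝ) => (t : UnitAddCircle)) b → f a = f b := by
    intro a b hab
    have : ∀ i, ∃ n : ℤ, b i + n = a i := by
      intro i
      have hi : ((a i : ℝ) : UnitAddCircle) = (b i : ℝ) := congrFun hab i
      rw [← sub_eq_zero, ← AddCircle.coe_sub] at hi
      obtain ⟨n, hn⟩ := (AddCircle.coe_eq_zero_iff (1 : ℝ)).1 hi
      rw [zsmul_one] at hn
      exact ⟨n, by rw [hn]; ring⟩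
    choose k hk using this
    rw [← hper b k]
    congr 1
    ext i
    exact (hk i).symm
  let q : C(Fin d → ℝ, UnitAddTorus (Fin d)) := ⟨_, hq.continuous⟩
  have hq' : Topology.IsQuotientMap q := hq.isQuotientMap
  exact ⟨hq'.lift ⟨f, hf⟩ hfac, fun y => DFunLike.congr_fun (hq'.lift_comp ⟨f, hf⟩ hfac) y⟩

lemma norm_average_sub_le (N : ℕ) (u w : ℕ → ℂ) {ε : ℝ} (hε : 0 ≤ ε)
    (h : ∀ n, ‖u n - w n‖ ≤ ε) :
    ‖(N : ℂ)⁻¹ • ∑ n ∈ Finset.range N, u n - (N : ℂ)⁻¹ • ∑ n ∈ Finset.range N, w n‖ ≤ ε := by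
  rw [← smul_sub, ← Finset.sum_sub_distrib, norm_smul, norm_inv, Complex.norm_natCast]
  have h1 : ‖∑ n ∈ Finset.range N, (u n - w n)‖ ≤ N * ε := by
    simpa using norm_sum_le_of_le (Finset.range N) fun n _ => h n
  rcases Nat.eq_zero_or_pos N with rfl | hN
  · simpa using hε
  · rw [inv_mul_le_iff₀ (by positivity)]
    exact h1

/-- **Weyl's criterion**: it suffices to test uniform distribution on nontrivial characters. -/
lemma udMod1_of_torusChar {x : ℕ → Fin d → ℝ}
    (hx : ∀ h : Fin d → ℤ, h ≠ 0 → Tendsto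
      (fun N : ℕ => (N : ℂ)⁻¹ • ∑ n ∈ Finset.range N, torusChar h (x n)) atTop (nhds 0)) :
    UDMod1 x := by
  intro f hf hper
  obtain ⟨F, hF⟩ := exists_continuousMap_torus hf hper
  set π : (Fin d → ℝ) → UnitAddTorus (Fin d) := fun y i => ((y i : ℝ) : UnitAddCircle) with hπdef
  have hπ : Continuous π := continuous_pi fun i =>
    (AddCircle.continuous_mk' 1).comp (continuous_apply i)
  have hint : ∀ P : C(UnitAddTorus (Fin d), ℂ),
      IntegrableOn (fun y => P (π y)) (Set.Icc (0 : Fin d → ℝ) 1) := fun P =>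
    (P.continuous.comp hπ).continuousOn.integrableOn_compact isCompact_Icc
  have hspan : ∀ P ∈ Submodule.span ℂ (Set.range (UnitAddTorus.mFourier (d := Fin d))),
      Tendsto (fun N : ℕ => (N : ℂ)⁻¹ • ∑ n ∈ Finset.range N, P (π (x n))) atTop
        (nhds (∫ y in Set.Icc (0 : Fin d → ℝ) 1, P (π y))) := by
    intro P hP
    induction hP using Submodule.span_induction with
    | mem P hP =>
      obtain ⟨h, rfl⟩ := hP
      simp only [hπdef, mFourier_coe_eq_torusChar]
      by_cases hh : h = 0
      · subst hh
        rw [integral_torusChar_zero]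
        refine tendsto_const_nhds.congr' ?_
        filter_upwards [eventually_ne_atTop 0] with N hN
        simp [torusChar_zero, hN]
      · rw [integral_torusChar hh]
        exact hx h hh
    | zero => simp
    | add P Q _ _ hP hQ =>
      simp only [ContinuousMap.add_apply, Finset.sum_add_distrib, smul_add]
      rw [integral_add (hint P) (hint Q)]
      exact hP.add hQ
    | smul c P _ hP =>
      simp only [ContinuousMap.smul_apply, ← Finset.smul_sum]
      rw [integral_smul]
      simpa only [smul_comm c] using hP.const_smul c
  have hdense : F ∈ (Submodule.span ℂ
      (Set.range (UnitAddTorus.mFourier (d := Fin d)))).topologicalClosure := by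
    rw [UnitAddTorus.span_mFourier_closure_eq_top]
    trivial
  rw [← SetLike.mem_coe, Submodule.topologicalClosure_coe, Metric.mem_closure_iff] at hdense
  rw [Metric.tendsto_atTop]
  intro ε hε
  obtain ⟨P, hP, hFP⟩ := hdense (ε / 3) (by positivity)
  obtain ⟨N₀, hN₀⟩ := Metric.tendsto_atTop.1 (hspan P hP) (ε / 3) (by positivity)
  have hclose : ∀ y, ‖f y - P (π y)‖ ≤ ε / 3 := fun y => by
    rw [← hF, ← dist_eq_norm]
    exact (ContinuousMap.dist_apply_le_dist _).trans hFP.le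
  have hI : ‖(∫ y in Set.Icc (0 : Fin d → ℝ) 1, f y)
      - ∫ y in Set.Icc (0 : Fin d → ℝ) 1, P (π y)‖ ≤ ε / 3 := by
    rw [← integral_sub (hf.continuousOn.integrableOn_compact isCompact_Icc) (hint P)]
    refine (norm_setIntegral_le_of_norm_le_const (C := ε / 3) ?_ fun y _ => hclose y).trans ?_
    · simp [Real.volume_Icc_pi]
    · simp [measureReal_def, Real.volume_Icc_pi]
  refine ⟨N₀, fun N hN => ?_⟩
  have h1 := norm_average_sub_le N (fun n => f (x n)) (fun n => P (π (x n))) (by positivity)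
    fun n => hclose (x n)
  have h2 := hN₀ N hN
  rw [← dist_eq_norm] at h1 hI
  rw [dist_comm] at hI
  calc _ ≤ _ := dist_triangle4 _ _ _ _
    _ < ε / 3 + ε / 3 + ε / 3 := by
      refine add_lt_add_of_lt_of_le (add_lt_add_of_le_of_lt h1 h2) hI
    _ = ε := by ring

end Weyl

section VanDerCorput

lemma norm_sum_shift_sub_le {u : ℕ → ℂ} (hu : ∀ n, ‖u n‖ ≤ 1) (N m : ℕ) :
    ‖∑ n ∈ Finset.range N, u (n + m) - ∑ n ∈ Finset.range N, u n‖ ≤ 2 * m := by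
  induction m with
  | zero => simp
  | succ m ih =>
    have h1 : ∑ n ∈ Finset.range N, u (n + (m + 1)) - ∑ n ∈ Finset.range N, u (n + m)
        = u (N + m) - u (0 + m) := by
      rw [← Finset.sum_sub_distrib, ← Finset.sum_range_sub (fun n => u (n + m)) N]
      refine Finset.sum_congr rfl fun n _ => ?_
      congr 2
      ring
    have h2 : ‖u (N + m) - u (0 + m)‖ ≤ 2 :=
      (norm_sub_le _ _).trans (by linarith [hu (N + m), hu (0 + m)])
    rw [← h1] at h2
    have := norm_add_le
      (∑ n ∈ Finset.range N, u (n + (m + 1)) - ∑ n ∈ Finset.range N, u (n + m))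
      (∑ n ∈ Finset.range N, u (n + m) - ∑ n ∈ Finset.range N, u n)
    rw [sub_add_sub_cancel] at this
    push_cast
    linarith

/-- If the windowed sums of length `M` of a bounded sequence have mean square `O(M)`, uniformly
in `M`, then the averages of the sequence tend to zero. -/
lemma tendsto_average_zero_of_window {u : ℕ → ℂ} (hu : ∀ n, ‖u n‖ ≤ 1) (C : ℝ)
    (hw : ∀ M : ℕ, 0 < M → ∀ᶠ N : ℕ in atTop,
      ∑ n ∈ Finset.range N, ‖∑ m ∈ Finset.range M, u (n + m)‖ ^ 2 ≤ C * M * N) :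
    Tendsto (fun N : ℕ => (N : ℂ)⁻¹ • ∑ n ∈ Finset.range N, u n) atTop (nhds 0) := by
  rw [Metric.tendsto_nhds]
  intro ε hε
  obtain ⟨M, hM⟩ := exists_nat_gt (max 0 (C / (ε / 4) ^ 2))
  have hM0 : (0 : ℝ) < M := (le_max_left _ _).trans_lt hM
  have hMC : C ≤ M * (ε / 4) ^ 2 := by
    have := ((le_max_right _ _).trans_lt hM).le
    rwa [div_le_iff₀ (by positivity)] at this
  obtain ⟨N₀, hN₀⟩ := exists_nat_gt (8 * M / ε)
  filter_upwards [hw M (by exact_mod_cast hM0), eventually_ge_atTop N₀, eventually_gt_atTop 0]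
    with N hN hNN hNpos
  have hNpos' : (0 : ℝ) < N := by exact_mod_cast hNpos
  have hNbig : 8 * M < ε * N := by
    have : 8 * M / ε < N := hN₀.trans_le (by exact_mod_cast hNN)
    rwa [div_lt_iff₀ hε, mul_comm _ ε] at this
  set G : ℕ → ℂ := fun n => ∑ m ∈ Finset.range M, u (n + m) with hG
  have hsq : ‖∑ n ∈ Finset.range N, G n‖ ^ 2 ≤ (M * (ε / 4) * N) ^ 2 := by
    calc ‖∑ n ∈ Finset.range N, G n‖ ^ 2 ≤ (∑ n ∈ Finset.range N, ‖G n‖) ^ 2 := by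
          gcongr
          exact norm_sum_le _ _
      _ ≤ N * ∑ n ∈ Finset.range N, ‖G n‖ ^ 2 := by
          simpa using sq_sum_le_card_mul_sum_sq (s := Finset.range N) (f := fun n => ‖G n‖)
      _ ≤ N * (C * M * N) := by gcongr
      _ ≤ N * ((M * (ε / 4) ^ 2) * M * N) := by gcongr
      _ = _ := by ring
  have h1 : ‖∑ n ∈ Finset.range N, G n‖ ≤ M * (ε / 4) * N :=
    le_of_sq_le_sq hsq (by positivity)
  have h2 : ‖∑ n ∈ Finset.range N, G n - M * ∑ n ∈ Finset.range N, u n‖ ≤ M * (2 * M) := by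
    have : ∑ n ∈ Finset.range N, G n - M * ∑ n ∈ Finset.range N, u n = ∑ m ∈ Finset.range M,
        (∑ n ∈ Finset.range N, u (n + m) - ∑ n ∈ Finset.range N, u n) := by
      rw [Finset.sum_sub_distrib, hG, Finset.sum_comm]
      simp
    rw [this]
    have := norm_sum_le_of_le (Finset.range M) (f := fun m =>
      ∑ n ∈ Finset.range N, u (n + m) - ∑ n ∈ Finset.range N, u n) (n := fun _ => 2 * (M : ℝ))
      fun m hm => (norm_sum_shift_sub_le hu N m).trans (by
        have : (m : ℝ) ≤ M := by exact_mod_cast (Finset.mem_range.1 hm).le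
        linarith)
    simpa using this
  have h3 : M * ‖∑ n ∈ Finset.range N, u n‖ ≤ M * (ε / 4 * N + 2 * M) := by
    have := norm_sub_norm_le (M * ∑ n ∈ Finset.range N, u n) (∑ n ∈ Finset.range N, G n)
    rw [norm_sub_rev, norm_mul, Complex.norm_natCast] at this
    linarith
  have h4 := le_of_mul_le_mul_left h3 hM0
  rw [dist_zero_right, norm_smul, norm_inv, Complex.norm_natCast, inv_mul_lt_iff₀ hNpos']
  nlinarith

end VanDerCorput

section Orbit

variable {d : ℕ}

/-- Mean square of a sum of distinct characters along a uniformly distributed sequence. -/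
lemma UDMod1.tendsto_sq_sum_torusChar {x : ℕ → Fin d → ℝ} (hx : UDMod1 x) (g : ℕ → Fin d → ℤ)
    (hg : Function.Injective g) (M : ℕ) :
    Tendsto (fun N : ℕ => (N : ℝ)⁻¹ * ∑ n ∈ Finset.range N,
      ‖∑ m ∈ Finset.range M, torusChar (g m) (x n)‖ ^ 2) atTop (nhds M) := by
  set f : (Fin d → ℝ) → ℂ := fun y =>
    ∑ m ∈ Finset.range M, ∑ l ∈ Finset.range M, torusChar (g m - g l) y with hf
  have hsq : ∀ y, f y = ((‖∑ m ∈ Finset.range M, torusChar (g m) y‖ ^ 2 : ℝ) : ℂ) := by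
    intro y
    rw [Complex.ofReal_pow, ← Complex.mul_conj', map_sum, Finset.sum_mul_sum]
    simp only [hf, torusChar_sub]
  have hint : ∫ y in Set.Icc (0 : Fin d → ℝ) 1, f y = M := by
    have hi : ∀ h : Fin d → ℤ, IntegrableOn (torusChar h) (Set.Icc (0 : Fin d → ℝ) 1) := fun h =>
      (continuous_torusChar h).continuousOn.integrableOn_compact isCompact_Icc
    simp only [hf]
    rw [integral_finsetSum _ fun m _ => integrable_finsetSum _ fun l _ => hi _]
    have : ∀ m ∈ Finset.range M, ∫ y in Set.Icc (0 : Fin d → ℝ) 1,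
        ∑ l ∈ Finset.range M, torusChar (g m - g l) y = 1 := by
      intro m hm
      rw [integral_finsetSum _ fun l _ => hi _, Finset.sum_eq_single_of_mem m hm, sub_self,
        integral_torusChar_zero]
      intro l _ hl
      exact integral_torusChar (sub_ne_zero.2 fun h => hl (hg h).symm)
    rw [Finset.sum_congr rfl this]
    simp
  have := hx f
    (continuous_finsetSum _ fun m _ => continuous_finsetSum _ fun l _ => continuous_torusChar _)
    (fun y k => by simp only [hf, torusChar_periodic])
  rw [hint, ← Complex.ofReal_natCast M] at this
  refine tendsto_ofReal_iff.1 (this.congr fun N => ?_)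
  simp only [hsq, smul_eq_mul]
  push_cast
  rfl

/-- If almost every point of the line `ℝ v` has a uniformly distributed `A`-orbit, then no
nontrivial character is periodic under `A`. -/
lemma eq_zero_of_vecMul_pow_eq {A : Matrix (Fin d) (Fin d) ℤ} {v : Fin d → ℝ}
    (hud : ∀ᵐ ω ∂(volume : Measure ℝ),
      UDMod1 (fun n => ((A.map (Int.cast : ℤ → ℝ)) ^ n) *ᵥ (ω • v)))
    {p : ℕ} (hp : 0 < p) {h : Fin d → ℤ} (hA : h ᵥ* A ^ p = h) : h = 0 := by
  by_contra hh
  set G : ℝ → ℂ := fun ω => ∑ j ∈ Finset.range p, torusChar (h ᵥ* A ^ j) (ω • v) with hG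
  have hper : ∀ j M : ℕ, h ᵥ* A ^ (p * M + j) = h ᵥ* A ^ j := by
    intro j M
    have : h ᵥ* A ^ (p * M) = h := by
      induction M with
      | zero => simp
      | succ M ih => rw [mul_add_one, pow_add, ← vecMul_vecMul, ih, hA]
    rw [pow_add, ← vecMul_vecMul, this]
  have hsum : ∀ (ω : ℝ) (M : ℕ),
      ∑ n ∈ Finset.range (p * M), torusChar (h ᵥ* A ^ n) (ω • v) = M * G ω := by
    intro ω M
    induction M with
    | zero => simp
    | succ M ih =>
      rw [mul_add_one, Finset.sum_range_add, ih]
      simp only [hper, hG]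
      push_cast
      ring
  have hae : G =ᵐ[volume] fun _ => 0 := by
    filter_upwards [hud] with ω hω
    have h1 := hω (torusChar h) (continuous_torusChar h) (torusChar_periodic h)
    rw [integral_torusChar hh] at h1
    simp only [torusChar_mulVec] at h1
    have h2 := h1.comp (tendsto_id.const_mul_atTop' hp)
    have h3 : Tendsto (fun _ : ℕ => (p : ℂ)⁻¹ * G ω) atTop (nhds 0) := by
      refine h2.congr' ?_
      filter_upwards [eventually_ne_atTop 0] with M hM
      have : (M : ℂ) ≠ 0 := by exact_mod_cast hM
      simp only [Function.comp_apply, id, hsum, smul_eq_mul]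
      push_cast
      field_simp
    have h4 := tendsto_nhds_unique h3 tendsto_const_nhds
    simpa [hp.ne'] using h4
  have hcont : Continuous G := continuous_finsetSum _ fun j _ =>
    (continuous_torusChar _).comp (continuous_id.smul continuous_const)
  have h0 := congrFun ((hcont.ae_eq_iff_eq volume continuous_const).1 hae) 0
  simp [hG, torusChar_apply_zero, hp.ne'] at h0

/-- If no nontrivial character is periodic under `A`, then uniform distribution of an `A`-orbit
passes to arithmetic progressions. -/
lemma UDMod1.arithmetic_progression {A : Matrix (Fin d) (Fin d) ℤ} (hA : A.det ≠ 0)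
    (hper : ∀ p : ℕ, 0 < p → ∀ h : Fin d → ℤ, h ᵥ* A ^ p = h → h = 0) {w : Fin d → ℝ}
    (hud : UDMod1 (fun n => ((A.map (Int.cast : ℤ → ℝ)) ^ n) *ᵥ w)) {k : ℕ} (hk : 1 ≤ k) (ℓ : ℕ) :
    UDMod1 (fun n => ((A.map (Int.cast : ℤ → ℝ)) ^ (k * n + ℓ)) *ᵥ w) := by
  refine udMod1_of_torusChar fun h hh => ?_
  have hinj : Function.Injective fun m : ℕ => h ᵥ* A ^ (k * m) := by
    refine .of_lt_imp_ne fun a b hab heq => hh ?_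
    refine hper (k * (b - a)) (by have := Nat.sub_pos_of_lt hab; positivity) h ?_
    rw [← sub_eq_zero]
    refine eq_zero_of_vecMul_eq_zero (M := A ^ (k * a)) (by rw [det_pow]; exact pow_ne_zero _ hA) ?_
    rw [sub_vecMul, vecMul_vecMul, ← pow_add, ← mul_add, Nat.sub_add_cancel hab.le, sub_eq_zero]
    exact heq.symm
  refine tendsto_average_zero_of_window (fun n => (norm_torusChar _ _).le) (2 * (k + ℓ))
    fun M hM => ?_
  have hM' : (0 : ℝ) < M := by exact_mod_cast hM
  have hev := (hud.tendsto_sq_sum_torusChar _ hinj M).eventually_le_const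
    (show (M : ℝ) < 2 * M by linarith)
  have htop : Tendsto (fun N : ℕ => k * N + ℓ) atTop atTop :=
    tendsto_atTop_mono (fun N => by simp only [id]; nlinarith) tendsto_id
  filter_upwards [htop.eventually hev, eventually_gt_atTop 0] with N hN hNpos
  have hL : (0 : ℝ) < ((k * N + ℓ : ℕ) : ℝ) := by
    have : 0 < k * N + ℓ := by positivity
    exact_mod_cast this
  rw [inv_mul_le_iff₀ hL] at hN
  have hwin : ∀ n, ∑ m ∈ Finset.range M,
      torusChar h (((A.map (Int.cast : ℤ → ℝ)) ^ (k * (n + m) + ℓ)) *ᵥ w) =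
      ∑ m ∈ Finset.range M, torusChar (h ᵥ* A ^ (k * m))
        (((A.map (Int.cast : ℤ → ℝ)) ^ (k * n + ℓ)) *ᵥ w) := by
    intro n
    refine Finset.sum_congr rfl fun m _ => ?_
    rw [torusChar_mulVec, torusChar_mulVec, vecMul_vecMul, ← pow_add]
    congr 3
    ring
  simp only [hwin]
  have hsub : ∑ n ∈ Finset.range N, ‖∑ m ∈ Finset.range M, torusChar (h ᵥ* A ^ (k * m))
        (((A.map (Int.cast : ℤ → ℝ)) ^ (k * n + ℓ)) *ᵥ w)‖ ^ 2 ≤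
      ∑ n ∈ Finset.range (k * N + ℓ), ‖∑ m ∈ Finset.range M, torusChar (h ᵥ* A ^ (k * m))
        (((A.map (Int.cast : ℤ → ℝ)) ^ n) *ᵥ w)‖ ^ 2 := by
    have hi : Set.InjOn (fun n => k * n + ℓ) (Finset.range N) := fun a _ b _ hab =>
      Nat.eq_of_mul_eq_mul_left hk (Nat.add_right_cancel hab)
    rw [← Finset.sum_image (f := fun n => ‖∑ m ∈ Finset.range M, torusChar (h ᵥ* A ^ (k * m))
        (((A.map (Int.cast : ℤ → ℝ)) ^ n) *ᵥ w)‖ ^ 2) hi]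
    refine Finset.sum_le_sum_of_subset_of_nonneg ?_ fun _ _ _ => by positivity
    intro j hj
    obtain ⟨n, hn, rfl⟩ := Finset.mem_image.1 hj
    rw [Finset.mem_range] at hn ⊢
    have := Nat.mul_lt_mul_of_pos_left hn hk
    omega
  refine (hsub.trans hN).trans ?_
  have hN1 : (1 : ℝ) ≤ N := by exact_mod_cast hNpos
  have : ((k * N + ℓ : ℕ) : ℝ) ≤ (k + ℓ) * N := by
    push_cast
    nlinarith [Nat.cast_nonneg (α := ℝ) ℓ]
  nlinarith

end Orbit

theorem stmt4 (d : ℕ) (A : Matrix (Fin d) (Fin d) ℤ) (hA : A.det ≠ 0) (v : Fin d → ℚ)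
    (hud : ∀ᵐ ω ∂(volume : Measure ℝ),
      UDMod1 (fun n => ((A.map (Int.cast : ℤ → ℝ)) ^ n) *ᵥ (ω • fun i => ((v i : ℝ))))) :
    ∀ (k : ℕ), 1 ≤ k → ∀ (ℓ : ℕ),
      ∀ᵐ ω ∂(volume : Measure ℝ),
        UDMod1 (fun n =>
          ((A.map (Int.cast : ℤ → ℝ)) ^ (k * n + ℓ)) *ᵥ (ω • fun i => ((v i : ℝ)))) := by
  intro k hk ℓ
  filter_upwards [hud] with ω hω
  exact hω.arithmetic_progression hA (fun p hp h => eq_zero_of_vecMul_pow_eq hud hp) hk ℓ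
end

section
/- Let A ∈ M_d(ℤ) and let θ_1 be a simple eigenvalue of A (a root of multiplicity 1 of its characteristic polynomial), with minimal polynomial p over ℚ. Then the characteristic polynomial and the minimal polynomial of the restriction of A to the ℚ-subspace U = ker p(A) ≤ ℚ^d both equal p; consequently, Span_ℝ(U) is the minimal subspace (with respect to A) of every nonzero vector v ∈ Span_ℝ(U). -/
open Matrix Polynomial

/-- The ℝ-linear span inside `ℝ^d` of a ℚ-subspace of `ℚ^d`. -/
def spanR {d : ℕ} (W : Submodule ℚ (Fin d → ℚ)) : Submodule ℝ (Fin d → ℝ) :=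
  Submodule.span ℝ ((fun (w : Fin d → ℚ) => (fun i => ((w i : ℝ)))) '' (W : Set (Fin d → ℚ)))

namespace Matrix

theorem charpoly_dvd_pow_of_aeval_eq_zero {R n : Type*} [CommRing R] [Fintype n] [DecidableEq n]
    (M : Matrix n n R) {p : R[X]} (hp : aeval M p = 0) :
    M.charpoly ∣ p ^ Fintype.card n := by
  have hdvd : (X - C X : R[X][X]) ∣ p.map C - C p := by
    simpa [eval_map, eval₂_C_X] using X_sub_C_dvd_sub_C_eval (a := (X : R[X])) (p := p.map C)
  obtain ⟨q, hq⟩ := hdvd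
  have hM : aeval (M.map (C : R →+* R[X])) (p.map C) = 0 := by
    have h : (C : R →+* R[X]).mapMatrix (aeval M p) =
        aeval (M.map (C : R →+* R[X])) (p.map C) := by
      refine map_aeval_eq_aeval_map ?_ p M
      ext a i j : 3
      simp [algebraMap_matrix_apply, apply_ite (C : R →+* R[X])]
    rw [← h, hp, map_zero]
  have hmul := congrArg (aeval (M.map (C : R →+* R[X]))) hq
  rw [map_sub, hM, map_mul, map_sub, aeval_X, aeval_C, aeval_C] at hmul
  have hdet : scalar n p = M.charmatrix * aeval (M.map (C : R →+* R[X])) q := by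
    have hc : M.charmatrix = scalar n X - M.map C := rfl
    rw [hc, ← neg_sub, neg_mul]
    rw [zero_sub] at hmul
    exact neg_eq_iff_eq_neg.1 hmul
  have := congrArg det hdet
  rw [det_mul] at this
  refine ⟨_, Eq.trans ?_ this⟩
  simp

end Matrix

namespace LinearMap

variable {K V : Type*} [Field K] [AddCommGroup V] [Module K V]

theorem aeval_restrict_eq_zero (f : V →ₗ[K] V) {p : K[X]} {W : Submodule K V}
    (hW : ∀ x ∈ W, f x ∈ W) (hp : W ≤ ker (aeval f p)) : aeval (f.restrict hW) p = 0 := by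
  ext x
  have h : ((aeval (f.restrict hW) p x : W) : V) = aeval f p (x : V) := by
    have hpow (n : ℕ) (x : W) : (((f.restrict hW) ^ n) x : V) = (f ^ n) (x : V) := by
      rw [Module.End.pow_restrict n hW]
      rfl
    simp [aeval_eq_sum_range, hpow]
  rw [h]
  exact hp x.2

variable [FiniteDimensional K V]

open Module.Basis in
theorem charpoly_restrict_dvd (f : V →ₗ[K] V) (W : Submodule K V) (hW : W ≤ W.comap f) :
    (f.restrict hW).charpoly ∣ f.charpoly := by
  let bW := Module.finBasis K W
  let bQ := Module.finBasis K (V ⧸ W)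
  let b := sumQuot bW bQ
  have hmat : LinearMap.toMatrix b b f = Matrix.fromBlocks
      (LinearMap.toMatrix bW bW (f.restrict hW)) (LinearMap.toMatrix b b f).toBlocks₁₂ 0
      (LinearMap.toMatrix b b f).toBlocks₂₂ := by
    ext (i | i) (j | j)
    · simp only [b, sumQuot_inl, Matrix.fromBlocks_apply₁₁, LinearMap.toMatrix_apply]
      apply sumQuot_repr_inl_of_mem
    · rfl
    · suffices W.mkQ (f (bW j)) = 0 by simp [LinearMap.toMatrix_apply, b, this]
      rw [← LinearMap.mem_ker, Submodule.ker_mkQ]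
      exact hW (Submodule.coe_mem (bW j))
    · rfl
  rw [← charpoly_toMatrix f b, hmat, Matrix.charpoly_fromBlocks_zero₂₁, charpoly_toMatrix]
  exact dvd_mul_right _ _

theorem charpoly_dvd_pow_of_aeval_eq_zero (f : V →ₗ[K] V) {p : K[X]} (hp : aeval f p = 0) :
    f.charpoly ∣ p ^ Module.finrank K V := by
  let b := Module.finBasis K V
  have h : aeval (toMatrix b b f) p = 0 := by
    have := aeval_algHom_apply (toMatrixAlgEquiv b : _ ≃ₐ[K] Matrix _ _ K) f p
    rw [hp, map_zero] at this
    exact this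
  simpa [charpoly_toMatrix] using Matrix.charpoly_dvd_pow_of_aeval_eq_zero _ h

theorem exists_charpoly_eq_pow (f : V →ₗ[K] V) {p : K[X]} (hirr : Irreducible p)
    (hmonic : p.Monic) (hp : aeval f p = 0) : ∃ k, f.charpoly = p ^ k := by
  obtain ⟨k, -, hk⟩ := (dvd_prime_pow hirr.prime _).1 (f.charpoly_dvd_pow_of_aeval_eq_zero hp)
  exact ⟨k, eq_of_monic_of_associated f.charpoly_monic (hmonic.pow k) hk⟩

theorem natDegree_le_finrank_of_aeval_eq_zero [Nontrivial V] (f : V →ₗ[K] V) {p : K[X]}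
    (hirr : Irreducible p) (hmonic : p.Monic) (hp : aeval f p = 0) :
    p.natDegree ≤ Module.finrank K V := by
  obtain ⟨k, hk⟩ := f.exists_charpoly_eq_pow hirr hmonic hp
  have hdeg := f.charpoly_natDegree
  rw [hk, natDegree_pow] at hdeg
  have hpos : 0 < Module.finrank K V := Module.finrank_pos
  have : k ≠ 0 := by rintro rfl; simp at hdeg; omega
  rw [← hdeg]
  exact Nat.le_mul_of_pos_left _ (Nat.pos_of_ne_zero this)

theorem ker_aeval_ne_bot (f : V →ₗ[K] V) {p : K[X]} (hirr : Irreducible p)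
    (hp : p ∣ f.charpoly) : ker (aeval f p) ≠ ⊥ := by
  intro hbot
  obtain ⟨q, hq⟩ := hirr.prime.dvd_of_dvd_pow
    (hp.trans (f.charpoly_dvd_pow_of_aeval_eq_zero (minpoly.aeval K f)))
  have hne := minpoly.ne_zero (Algebra.IsIntegral.isIntegral (R := K) f)
  have hq0 : aeval f q = 0 := by
    ext x
    have h : aeval f p (aeval f q x) = 0 := by
      rw [← Module.End.mul_apply, ← map_mul, ← hq, minpoly.aeval, zero_apply]
    exact (ker_eq_bot'.1 hbot) _ h
  have hqne : q ≠ 0 := by rintro rfl; simp [hq] at hne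
  have hdeg := natDegree_le_of_dvd (minpoly.dvd K f hq0) hqne
  rw [hq, natDegree_mul hirr.ne_zero hqne] at hdeg
  have := hirr.natDegree_pos
  omega

theorem charpoly_restrict_ker_aeval (f : V →ₗ[K] V) {p : K[X]} (hirr : Irreducible p)
    (hmonic : p.Monic) (hp : p ∣ f.charpoly) (hsq : ¬ p ^ 2 ∣ f.charpoly)
    (hinv : ∀ x ∈ ker (aeval f p), f x ∈ ker (aeval f p)) :
    (f.restrict hinv).charpoly = p := by
  have : Nontrivial (ker (aeval f p)) :=
    (Submodule.nontrivial_iff_ne_bot).2 (f.ker_aeval_ne_bot hirr hp)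
  have hzero := f.aeval_restrict_eq_zero hinv le_rfl
  obtain ⟨k, hk⟩ := (f.restrict hinv).exists_charpoly_eq_pow hirr hmonic hzero
  have hle : k ≤ 1 := by
    by_contra! h
    exact hsq ((pow_dvd_pow p h).trans (hk ▸ f.charpoly_restrict_dvd _ hinv))
  refine eq_of_monic_of_associated (charpoly_monic _) hmonic
    (associated_of_dvd_of_natDegree_le ?_ hmonic.ne_zero ?_)
  · rw [hk]
    simpa using pow_dvd_pow p hle
  · rw [charpoly_natDegree]
    exact (f.restrict hinv).natDegree_le_finrank_of_aeval_eq_zero hirr hmonic hzero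

theorem minpoly_restrict_ker_aeval (f : V →ₗ[K] V) {p : K[X]} (hirr : Irreducible p)
    (hmonic : p.Monic) (hp : p ∣ f.charpoly)
    (hinv : ∀ x ∈ ker (aeval f p), f x ∈ ker (aeval f p)) :
    minpoly K (f.restrict hinv) = p := by
  have : Nontrivial (ker (aeval f p)) :=
    (Submodule.nontrivial_iff_ne_bot).2 (f.ker_aeval_ne_bot hirr hp)
  exact (minpoly.eq_of_irreducible_of_monic hirr (f.aeval_restrict_eq_zero hinv le_rfl)
    hmonic).symm

theorem ker_aeval_le_of_inf_ne_bot (f : V →ₗ[K] V) {p : K[X]} (hirr : Irreducible p)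
    (hmonic : p.Monic) (hp : p ∣ f.charpoly) (hsq : ¬ p ^ 2 ∣ f.charpoly)
    (hinv : ∀ x ∈ ker (aeval f p), f x ∈ ker (aeval f p)) {W : Submodule K V}
    (hW : ∀ x ∈ W, f x ∈ W) (hne : ker (aeval f p) ⊓ W ≠ ⊥) : ker (aeval f p) ≤ W := by
  have : Nontrivial ↥(ker (aeval f p) ⊓ W) := (Submodule.nontrivial_iff_ne_bot).2 hne
  have hinf : ∀ x ∈ ker (aeval f p) ⊓ W, f x ∈ ker (aeval f p) ⊓ W :=
    fun x hx ↦ ⟨hinv x hx.1, hW x hx.2⟩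
  rw [← inf_eq_left]
  refine Submodule.eq_of_le_of_finrank_le inf_le_left ?_
  rw [← charpoly_natDegree (f.restrict hinv), f.charpoly_restrict_ker_aeval hirr hmonic hp hsq]
  exact (f.restrict hinf).natDegree_le_finrank_of_aeval_eq_zero hirr hmonic
    (f.aeval_restrict_eq_zero hinf inf_le_left)

end LinearMap

theorem inf_ne_bot_of_mem_spanR {d : ℕ} {U W : Submodule ℚ (Fin d → ℚ)} {v : Fin d → ℝ}
    (hv : v ≠ 0) (hU : v ∈ spanR U) (hW : v ∈ spanR W) : U ⊓ W ≠ ⊥ := by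
  intro hbot
  obtain ⟨g, hg⟩ := (W.mkQ ∘ₗ U.subtype).exists_leftInverse_of_injective (by
    rw [LinearMap.ker_comp, Submodule.ker_mkQ]
    exact Submodule.disjoint_iff_comap_eq_bot.1 (disjoint_iff.2 hbot))
  let φ : (Fin d → ℚ) →ₗ[ℚ] (Fin d → ℚ) := U.subtype ∘ₗ g ∘ₗ W.mkQ
  have hφU : ∀ u ∈ U, φ u = u := fun u hu ↦
    congrArg Subtype.val (LinearMap.congr_fun hg ⟨u, hu⟩)
  have hφW : ∀ w ∈ W, φ w = 0 := fun w hw ↦ by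
    simp [φ, (Submodule.Quotient.mk_eq_zero W).2 hw]
  let M : Matrix (Fin d) (Fin d) ℝ := (LinearMap.toMatrix' φ).map (Rat.castHom ℝ)
  have hM (w : Fin d → ℚ) : M *ᵥ (fun i ↦ (w i : ℝ)) = fun i ↦ ((φ w i : ℚ) : ℝ) := by
    ext i
    rw [← LinearMap.toMatrix'_mulVec φ w]
    exact ((Rat.castHom ℝ).map_mulVec (LinearMap.toMatrix' φ) w i).symm
  have hMU : spanR U ≤ LinearMap.eqLocus M.mulVecLin LinearMap.id := by
    refine Submodule.span_le.2 ?_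
    rintro _ ⟨u, hu, rfl⟩
    simp [hM, hφU u hu]
  have hMW : spanR W ≤ LinearMap.ker M.mulVecLin := by
    refine Submodule.span_le.2 ?_
    rintro _ ⟨w, hw, rfl⟩
    simp [hM, hφW w hw]
    rfl
  have h₁ : M *ᵥ v = v := hMU hU
  have h₂ : M *ᵥ v = 0 := hMW hW
  exact hv (h₁.symm.trans h₂)

theorem Matrix.aeval_mulVecLin {n R : Type*} [Fintype n] [DecidableEq n] [CommRing R]
    (M : Matrix n n R) (p : R[X]) : aeval M.mulVecLin p = (aeval M p).mulVecLin :=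
  aeval_algHom_apply (toLinAlgEquiv' : Matrix n n R ≃ₐ[R] _) M p

theorem stmt11 (d : ℕ) (A : Matrix (Fin d) (Fin d) ℤ) (θ₁ : ℂ)
    -- `θ₁` is a simple eigenvalue of `A`
    (hsimple : ((A.charpoly).map (Int.castRingHom ℂ)).rootMultiplicity θ₁ = 1) :
    -- `U = ker p(A) ≤ ℚ^d`, where `p = minpoly ℚ θ₁`
    ∃ hinv : ∀ x ∈ LinearMap.ker (Polynomial.aeval
        (A.map (Int.cast : ℤ → ℚ)) (minpoly ℚ θ₁)).mulVecLin,
      (A.map (Int.cast : ℤ → ℚ)).mulVecLin x ∈ LinearMap.ker (Polynomial.aeval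
        (A.map (Int.cast : ℤ → ℚ)) (minpoly ℚ θ₁)).mulVecLin,
      -- the characteristic and minimal polynomials of `A|_U` both equal `p`
      (LinearMap.charpoly (((A.map (Int.cast : ℤ → ℚ)).mulVecLin).restrict hinv) =
          minpoly ℚ θ₁ ∧
        minpoly ℚ (((A.map (Int.cast : ℤ → ℚ)).mulVecLin).restrict hinv) = minpoly ℚ θ₁) ∧
      -- consequently, `Span_ℝ U` is the minimal subspace of every nonzero `v ∈ Span_ℝ U`
      (∀ v : Fin d → ℝ, v ≠ 0 →
        v ∈ spanR (LinearMap.ker (Polynomial.aeval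
          (A.map (Int.cast : ℤ → ℚ)) (minpoly ℚ θ₁)).mulVecLin) →
        ∀ W' : Submodule ℚ (Fin d → ℚ),
          (∀ w ∈ W', (A.map (Int.cast : ℤ → ℚ)) *ᵥ w ∈ W') → v ∈ spanR W' →
          LinearMap.ker (Polynomial.aeval
            (A.map (Int.cast : ℤ → ℚ)) (minpoly ℚ θ₁)).mulVecLin ≤ W') := by
  set B := A.map (Int.cast : ℤ → ℚ)
  set p := minpoly ℚ θ₁
  have hχ : B.mulVecLin.charpoly.map (algebraMap ℚ ℂ) = A.charpoly.map (Int.castRingHom ℂ) := by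
    have hB : B.charpoly = A.charpoly.map (Int.castRingHom ℚ) :=
      A.charpoly_map (Int.castRingHom ℚ)
    rw [Matrix.charpoly_mulVecLin, hB, Polynomial.map_map]
    congr 1
  rw [← hχ] at hsimple
  have hne : B.mulVecLin.charpoly.map (algebraMap ℚ ℂ) ≠ 0 :=
    (B.mulVecLin.charpoly_monic.map _).ne_zero
  have hroot : aeval θ₁ B.mulVecLin.charpoly = 0 := by
    rw [← eval_map_algebraMap]
    exact (rootMultiplicity_pos hne).1 (by omega)
  have hint : IsIntegral ℚ θ₁ := ⟨_, B.mulVecLin.charpoly_monic, hroot⟩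
  have hirr : Irreducible p := minpoly.irreducible hint
  have hmonic : p.Monic := minpoly.monic hint
  have hdvd : p ∣ B.mulVecLin.charpoly := minpoly.dvd ℚ θ₁ hroot
  have hsq : ¬ p ^ 2 ∣ B.mulVecLin.charpoly := by
    intro h
    have hX : X - C θ₁ ∣ p.map (algebraMap ℚ ℂ) := by
      rw [dvd_iff_isRoot, IsRoot.def, eval_map_algebraMap, minpoly.aeval]
    have h' := (pow_dvd_pow_of_dvd hX 2).trans
      ((Polynomial.map_pow (algebraMap ℚ ℂ) 2) ▸ Polynomial.map_dvd (algebraMap ℚ ℂ) h)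
    have := (le_rootMultiplicity_iff hne).2 h'
    omega
  rw [← B.aeval_mulVecLin p]
  have hinv : ∀ x ∈ LinearMap.ker (aeval B.mulVecLin p),
      B.mulVecLin x ∈ LinearMap.ker (aeval B.mulVecLin p) := by
    intro x hx
    rw [LinearMap.mem_ker] at hx ⊢
    have hcomm : aeval B.mulVecLin p * B.mulVecLin = B.mulVecLin * aeval B.mulVecLin p := by
      simpa using congrArg (aeval B.mulVecLin) (mul_comm p X)
    rw [← Module.End.mul_apply, hcomm, Module.End.mul_apply, hx, map_zero]
  exact ⟨hinv, ⟨B.mulVecLin.charpoly_restrict_ker_aeval hirr hmonic hdvd hsq hinv,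
      B.mulVecLin.minpoly_restrict_ker_aeval hirr hmonic hdvd hinv⟩,
    fun v hv hvU W hW hvW ↦ B.mulVecLin.ker_aeval_le_of_inf_ne_bot hirr hmonic hdvd hsq hinv hW
      (inf_ne_bot_of_mem_spanR hv hvU hvW)⟩
end

section
/- For every integer m ≥ 3, the matrix S = [[m, 1, 1], [1, 2m, 1], [1, 1, 2]] ∈ M₃(ℤ) has three real eigenvalues θ_1, θ_2, θ_3 satisfying 2m < θ_1 < 2m + 1, θ_2 = m, and 1 < θ_3 < 2; in particular θ_1 is irrational. -/
open Polynomial in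
theorem charpoly_eq_mul_quadratic (m : ℤ) :
    (!![m, 1, 1; 1, 2 * m, 1; 1, 1, 2]).charpoly =
      (X - C m) * (X ^ 2 - C (2 * m + 2) * X + C (4 * m - 3)) := by
  rw [Matrix.charpoly, Matrix.det_fin_three]
  simp
  ring

open Polynomial in
theorem quadratic_eq_mul_of_sq_eq {R : Type*} [CommRing R] {m s : R}
    (hs : s ^ 2 = (m - 1) ^ 2 + 3) :
    (X ^ 2 - C (2 * m + 2) * X + C (4 * m - 3) : R[X]) =
      (X - C (m + 1 + s)) * (X - C (m + 1 - s)) := by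
  have h : (C s : R[X]) ^ 2 = (C m - 1) ^ 2 + 3 := by
    simpa only [map_pow, map_add, map_sub, map_one, map_ofNat] using congrArg (C : R → R[X]) hs
  simp only [map_add, map_sub, map_mul, map_one, map_ofNat]
  linear_combination h

theorem irrational_sqrt_sub_one_sq_add_three {m : ℕ} (hm : 3 ≤ m) :
    Irrational √(((m : ℝ) - 1) ^ 2 + 3) := by
  have h : ((m : ℝ) - 1) ^ 2 + 3 = (((m - 1) ^ 2 + 3 : ℕ) : ℝ) := by
    push_cast [Nat.cast_sub (show 1 ≤ m by omega)]
    ring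
  rw [h, irrational_sqrt_natCast_iff]
  rintro ⟨k, hk⟩
  obtain ⟨n, rfl⟩ : ∃ n, m = n + 1 := ⟨m - 1, by omega⟩
  rw [Nat.add_sub_cancel] at hk
  have h₁ : n < k := by nlinarith
  have h₂ : k < n + 1 := by nlinarith
  omega

theorem stmt17 (m : ℕ) (hm : 3 ≤ m) :
    ∃ θ₁ θ₃ : ℝ,
      (((!![(m : ℤ), 1, 1; 1, 2 * (m : ℤ), 1; 1, 1, 2]).charpoly).map
          (Int.castRingHom ℝ)).roots = {θ₁, (m : ℝ), θ₃} ∧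
      2 * (m : ℝ) < θ₁ ∧ θ₁ < 2 * (m : ℝ) + 1 ∧
      1 < θ₃ ∧ θ₃ < 2 ∧ Irrational θ₁ := by
  have hm' : (3 : ℝ) ≤ m := by exact_mod_cast hm
  have hirr := irrational_sqrt_sub_one_sq_add_three hm
  have hs : √(((m : ℝ) - 1) ^ 2 + 3) ^ 2 = ((m : ℝ) - 1) ^ 2 + 3 := Real.sq_sqrt (by positivity)
  have hlo : (m : ℝ) - 1 < √(((m : ℝ) - 1) ^ 2 + 3) := Real.lt_sqrt_of_sq_lt (by linarith)
  have hhi : √(((m : ℝ) - 1) ^ 2 + 3) < m := by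
    rw [Real.sqrt_lt' (by linarith)]
    nlinarith
  generalize √(((m : ℝ) - 1) ^ 2 + 3) = s at *
  refine ⟨m + 1 + s, m + 1 - s, ?_, by linarith, by linarith, by linarith, by linarith, ?_⟩
  · have hfac : ((!![(m : ℤ), 1, 1; 1, 2 * (m : ℤ), 1; 1, 1, 2]).charpoly).map
        (Int.castRingHom ℝ) =
        (({(m : ℝ) + 1 + s, (m : ℝ), (m : ℝ) + 1 - s} : Multiset ℝ).map
          fun a => Polynomial.X - Polynomial.C a).prod := by
      have hq := quadratic_eq_mul_of_sq_eq hs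
      rw [charpoly_eq_mul_quadratic]
      simp only [Multiset.insert_eq_cons, Multiset.map_cons, Multiset.map_singleton,
        Multiset.prod_cons, Multiset.prod_singleton]
      rw [mul_left_comm, ← hq]
      simp [map_ofNat Polynomial.C]
    rw [hfac, Polynomial.roots_multiset_prod_X_sub_C]
  · simpa using hirr.natCast_add (m + 1)
end
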